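/- Let d ≥ 3. For every ρ ∈ (0,1) and every ε > 0 there exists D > 0, depending only on ρ, ε and d, such that for every past matrix N (i.e., every finite product of the matrices B₁ and B₂, including the identity): p({v ∈ Ω₁ : there exists i ≥ 0 with (S^i(v))[2] < ε·v[1] and C_max(N·M(v,i)) ≤ D·C_max(N)} | N) ≥ ρ. In words: with conditional probability at least ρ the second coordinate drops below ε times the initial first coordinate before the largest column sum increases by a factor of D. -/

import Mathlib

open MeasureTheory

noncomputable section

/-- The cone `Ω = {x ∈ ℝ^d : 0 ≤ x[1] ≤ … ≤ x[d] ≤ x[1]+x[2]}` intersected with the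
hyperplane `{x : x[1]+⋯+x[d] = 1}`, i.e. `Ω₁`, for `d = m + 3`, inside Euclidean space. -/
def selmerSimplexE (m : ℕ) : Set (EuclideanSpace ℝ (Fin (m + 3))) :=
  {x | 0 ≤ x 0 ∧ (∀ i j : Fin (m + 3), i ≤ j → x i ≤ x j) ∧
    x (Fin.last (m + 2)) ≤ x 0 + x 1 ∧ ∑ i, x i = 1}

/-- The restricted Selmer map `S : Ω → Ω`:
`S(x) = (x[1], x[d]−x[1], x[2], …, x[d−1])` if `x[d] ≥ 2x[1]`, and
`S(x) = (x[d]−x[1], x[1], x[2], …, x[d−1])` otherwise. -/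
def selmerS (m : ℕ) (x : Fin (m + 3) → ℝ) : Fin (m + 3) → ℝ := fun i =>
  if (i : ℕ) = 0 then
    (if 2 * x 0 ≤ x (Fin.last (m + 2)) then x 0 else x (Fin.last (m + 2)) - x 0)
  else if (i : ℕ) = 1 then
    (if 2 * x 0 ≤ x (Fin.last (m + 2)) then x (Fin.last (m + 2)) - x 0 else x 0)
  else x ⟨(i : ℕ) - 1, by have := i.isLt; omega⟩

/-- The matrix `B₁`, acting by `B₁y = (y[1], y[3], y[4], …, y[d], y[1]+y[2])`, so that
`B₁·S(x) = x` when `x[d] ≥ 2x[1]`. -/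
def selmerB1 (m : ℕ) : Matrix (Fin (m + 3)) (Fin (m + 3)) ℝ :=
  Matrix.of fun i j =>
    if (i : ℕ) = 0 then (if (j : ℕ) = 0 then 1 else 0)
    else if (i : ℕ) = m + 2 then (if (j : ℕ) ≤ 1 then 1 else 0)
    else if (j : ℕ) = (i : ℕ) + 1 then 1 else 0

/-- The matrix `B₂`, acting by `B₂y = (y[2], y[3], y[4], …, y[d], y[1]+y[2])`, so that
`B₂·S(x) = x` when `x[d] < 2x[1]`. -/
def selmerB2 (m : ℕ) : Matrix (Fin (m + 3)) (Fin (m + 3)) ℝ :=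
  Matrix.of fun i j =>
    if (i : ℕ) = 0 then (if (j : ℕ) = 1 then 1 else 0)
    else if (i : ℕ) = m + 2 then (if (j : ℕ) ≤ 1 then 1 else 0)
    else if (j : ℕ) = (i : ℕ) + 1 then 1 else 0

/-- The one-step matrix `B_{ι(x)}`, where `ι(x) = 1` if `x[d] ≥ 2x[1]` and `ι(x) = 2`
otherwise. -/
def selmerStep (m : ℕ) (x : Fin (m + 3) → ℝ) : Matrix (Fin (m + 3)) (Fin (m + 3)) ℝ :=
  if 2 * x 0 ≤ x (Fin.last (m + 2)) then selmerB1 m else selmerB2 m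

/-- The matrix of induction `M(x,n) = B_{ι(x)}·B_{ι(S(x))}···B_{ι(S^{n−1}(x))}`
(with `M(x,0) = Id`), so that `M(x,n)·Sⁿ(x) = x`. -/
def selmerMat (m : ℕ) (x : Fin (m + 3) → ℝ) : ℕ → Matrix (Fin (m + 3)) (Fin (m + 3)) ℝ
  | 0 => 1
  | n + 1 => selmerMat m x n * selmerStep m ((selmerS m)^[n] x)

/-- The `j`-th column sum `C_j(N)` of a matrix. -/
def colSum (m : ℕ) (N : Matrix (Fin (m + 3)) (Fin (m + 3)) ℝ) (j : Fin (m + 3)) : ℝ :=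
  ∑ i, N i j

/-- The largest column sum `C_max(N)` of a matrix. -/
def colMax (m : ℕ) (N : Matrix (Fin (m + 3)) (Fin (m + 3)) ℝ) : ℝ :=
  ⨆ j, colSum m N j

/-- `N` is `β`-balanced if `β·C_j(N) ≥ C_max(N)` for every `j`. -/
def IsBalanced (m : ℕ) (β : ℝ) (N : Matrix (Fin (m + 3)) (Fin (m + 3)) ℝ) : Prop :=
  ∀ j, colMax m N ≤ β * colSum m N j

/-- The conditional probability of `U ⊆ Ω₁` given the past matrix `N`:
`p(U|N) = (∫_U (C₁v[1]+⋯+C_d v[d])^{−d} dλ₀) / (∫_{Ω₁} (C₁v[1]+⋯+C_d v[d])^{−d} dλ₀)`,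
where `C_j = C_j(N)` and `λ₀` is the `(d−1)`-dimensional Hausdorff measure. -/
def selmerCondP (m : ℕ) (N : Matrix (Fin (m + 3)) (Fin (m + 3)) ℝ)
    (U : Set (EuclideanSpace ℝ (Fin (m + 3)))) : ℝ :=
  (∫ v in U, ((∑ j, colSum m N j * v j) ^ (m + 3))⁻¹ ∂(μH[(m + 2 : ℝ)])) /
    (∫ v in selmerSimplexE m, ((∑ j, colSum m N j * v j) ^ (m + 3))⁻¹ ∂(μH[(m + 2 : ℝ)]))

end

namespace SelmerAux

open Matrix

/-- The cone. -/
def Om (m : ℕ) : Set (Fin (m + 3) → ℝ) :=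
  {x | 0 ≤ x 0 ∧ (∀ i j : Fin (m + 3), i ≤ j → x i ≤ x j) ∧
    x (Fin.last (m + 2)) ≤ x 0 + x 1}

lemma sum_le_one (m : ℕ) (y : Fin (m + 3) → ℝ) :
    ∑ j : Fin (m + 3), (if (j : ℕ) ≤ 1 then (1 : ℝ) else 0) * y j = y 0 + y 1 := by
  rw [Fin.sum_univ_succ, Fin.sum_univ_succ]
  simp

lemma sum_eq_idx (m : ℕ) (y : Fin (m + 3) → ℝ) (k : ℕ) (hk : k < m + 3) :
    ∑ j : Fin (m + 3), (if (j : ℕ) = k then (1 : ℝ) else 0) * y j = y ⟨k, hk⟩ := by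
  rw [Finset.sum_eq_single (⟨k, hk⟩ : Fin (m + 3))]
  · simp
  · intro b _ hb
    have : (b : ℕ) ≠ k := fun h => hb (Fin.ext h)
    simp [this]
  · simp

lemma B1_mulVec (m : ℕ) (y : Fin (m + 3) → ℝ) (i : Fin (m + 3)) :
    (selmerB1 m *ᵥ y) i = if (i : ℕ) = 0 then y 0
      else if h : (i : ℕ) = m + 2 then y 0 + y 1
      else y ⟨(i : ℕ) + 1, by have := i.isLt; omega⟩ := by
  simp only [mulVec, dotProduct, selmerB1, Matrix.of_apply]
  split_ifs with h1 h2
  · exact sum_eq_idx m y 0 (by omega)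
  · exact sum_le_one m y
  · exact sum_eq_idx m y _ _

lemma B2_mulVec (m : ℕ) (y : Fin (m + 3) → ℝ) (i : Fin (m + 3)) :
    (selmerB2 m *ᵥ y) i = if (i : ℕ) = 0 then y 1
      else if h : (i : ℕ) = m + 2 then y 0 + y 1
      else y ⟨(i : ℕ) + 1, by have := i.isLt; omega⟩ := by
  simp only [mulVec, dotProduct, selmerB2, Matrix.of_apply]
  split_ifs with h1 h2
  · exact sum_eq_idx m y 1 (by omega)
  · exact sum_le_one m y
  · exact sum_eq_idx m y _ _

lemma S_zero (m : ℕ) (x : Fin (m + 3) → ℝ) : selmerS m x 0 =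
    if 2 * x 0 ≤ x (Fin.last (m + 2)) then x 0 else x (Fin.last (m + 2)) - x 0 := by
  simp [selmerS]

lemma S_one (m : ℕ) (x : Fin (m + 3) → ℝ) : selmerS m x 1 =
    if 2 * x 0 ≤ x (Fin.last (m + 2)) then x (Fin.last (m + 2)) - x 0 else x 0 := by
  simp [selmerS]

lemma S_big (m : ℕ) (x : Fin (m + 3) → ℝ) (i : Fin (m + 3)) (hi : 2 ≤ (i : ℕ)) :
    selmerS m x i = x ⟨(i : ℕ) - 1, by have := i.isLt; omega⟩ := by
  have h0 : (i : ℕ) ≠ 0 := by omega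
  have h1 : (i : ℕ) ≠ 1 := by omega
  simp [selmerS, h0, h1]

lemma B1_S (m : ℕ) (x : Fin (m + 3) → ℝ) (h : 2 * x 0 ≤ x (Fin.last (m + 2))) :
    selmerB1 m *ᵥ selmerS m x = x := by
  ext i
  rw [B1_mulVec, S_zero, S_one, if_pos h, if_pos h]
  split_ifs with h1 h2
  · congr 1; exact Fin.ext h1.symm
  · have : i = Fin.last (m + 2) := Fin.ext h2
    rw [this]; ring
  · rw [S_big _ _ _ (by simp; omega)]
    congr 1

lemma B2_S (m : ℕ) (x : Fin (m + 3) → ℝ) (h : ¬ 2 * x 0 ≤ x (Fin.last (m + 2))) :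
    selmerB2 m *ᵥ selmerS m x = x := by
  ext i
  rw [B2_mulVec, S_zero, S_one, if_neg h, if_neg h]
  split_ifs with h1 h2
  · congr 1; exact Fin.ext h1.symm
  · have : i = Fin.last (m + 2) := Fin.ext h2
    rw [this]; ring
  · rw [S_big _ _ _ (by simp; omega)]
    congr 1

lemma Om_01 {m : ℕ} {x : Fin (m + 3) → ℝ} (hx : x ∈ Om m) : x 0 ≤ x 1 :=
  hx.2.1 _ _ (Fin.zero_le _)
lemma Om_1l {m : ℕ} {x : Fin (m + 3) → ℝ} (hx : x ∈ Om m) : x 1 ≤ x (Fin.last (m + 2)) :=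
  hx.2.1 _ _ (Fin.le_last _)

lemma S_Om {m : ℕ} {x : Fin (m + 3) → ℝ} (hx : x ∈ Om m) : selmerS m x ∈ Om m := by
  have h01 := Om_01 hx
  have h1l := Om_1l hx
  obtain ⟨h0, hm, hl⟩ := hx
  have hS0 : 0 ≤ selmerS m x 0 := by rw [S_zero]; split_ifs <;> linarith
  have hS01 : selmerS m x 0 ≤ selmerS m x 1 := by
    rw [S_zero, S_one]; split_ifs <;> linarith
  have hS1 : selmerS m x 1 ≤ x 1 := by
    rw [S_one]; split_ifs <;> linarith
  have hbig : ∀ i : Fin (m + 3), 2 ≤ (i : ℕ) → selmerS m x 1 ≤ selmerS m x i := by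
    intro i hi
    rw [S_big m x i hi]
    refine hS1.trans (hm _ _ ?_)
    rw [Fin.le_def]; simp; omega
  refine ⟨hS0, ?_, ?_⟩
  · intro i j hij
    have hij' : (i : ℕ) ≤ j := hij
    rcases Nat.lt_or_ge (i : ℕ) 2 with hi | hi
    · rcases Nat.lt_or_ge (j : ℕ) 2 with hj | hj
      · have e1 : i = 0 ∨ i = 1 := by
          rcases Nat.lt_or_ge (i : ℕ) 1 with h | h
          · left; exact Fin.ext (by rw [Fin.val_zero]; omega)
          · right; exact Fin.ext (by rw [Fin.val_one]; omega)
        have e2 : j = 0 ∨ j = 1 := by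
          rcases Nat.lt_or_ge (j : ℕ) 1 with h | h
          · left; exact Fin.ext (by rw [Fin.val_zero]; omega)
          · right; exact Fin.ext (by rw [Fin.val_one]; omega)
        rcases e1 with rfl | rfl <;> rcases e2 with rfl | rfl
        · exact le_rfl
        · exact hS01
        · simp at hij'
        · exact le_rfl
      · have e1 : i = 0 ∨ i = 1 := by
          rcases Nat.lt_or_ge (i : ℕ) 1 with h | h
          · left; exact Fin.ext (by rw [Fin.val_zero]; omega)
          · right; exact Fin.ext (by rw [Fin.val_one]; omega)
        rcases e1 with rfl | rfl
        · exact hS01.trans (hbig j hj)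
        · exact hbig j hj
    · rw [S_big m x i hi, S_big m x j (by omega)]
      apply hm
      rw [Fin.le_def]; simp; omega
  · rw [S_big m x _ (by simp)]
    have : selmerS m x 0 + selmerS m x 1 = x (Fin.last (m + 2)) := by
      rw [S_zero, S_one]; split_ifs <;> ring
    rw [this]
    exact hm _ _ (Fin.le_last _)

lemma S_zero_le {m : ℕ} {x : Fin (m + 3) → ℝ} (_hx : x ∈ Om m) : selmerS m x 0 ≤ x 0 := by
  rw [S_zero]; split_ifs <;> linarith
lemma S_one_le {m : ℕ} {x : Fin (m + 3) → ℝ} (hx : x ∈ Om m) : selmerS m x 1 ≤ x 1 := by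
  have h01 := Om_01 hx
  obtain ⟨h0, hm, hl⟩ := hx
  rw [S_one]; split_ifs <;> linarith

lemma iter_Om {m : ℕ} {x : Fin (m + 3) → ℝ} (hx : x ∈ Om m) (n : ℕ) :
    (selmerS m)^[n] x ∈ Om m := by
  induction n with
  | zero => exact hx
  | succ n ih => rw [Function.iterate_succ_apply']; exact S_Om ih

lemma iter_zero_le {m : ℕ} {x : Fin (m + 3) → ℝ} (hx : x ∈ Om m) (n : ℕ) :
    (selmerS m)^[n] x 0 ≤ x 0 := by
  induction n with
  | zero => exact le_rfl
  | succ n ih => rw [Function.iterate_succ_apply']; exact (S_zero_le (iter_Om hx n)).trans ih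

/-- Forward maps. -/
lemma B_Om_aux {m : ℕ} {y x : Fin (m + 3) → ℝ} (hy : y ∈ Om m)
    (h0 : x 0 = y 0 ∨ x 0 = y 1) (hl : x (Fin.last (m + 2)) = y 0 + y 1)
    (hr : ∀ (i : ℕ) (hi : i < m + 1), x ⟨i + 1, by omega⟩ = y ⟨i + 2, by omega⟩) :
    x ∈ Om m := by
  have h01 := Om_01 hy
  obtain ⟨hy0, hm, hyl⟩ := hy
  have hx0 : 0 ≤ x 0 := by rcases h0 with h | h <;> rw [h] <;> linarith
  have hx0' : y 0 ≤ x 0 := by rcases h0 with h | h <;> rw [h] ; linarith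
  have hx0'' : x 0 ≤ y 1 := by rcases h0 with h | h <;> rw [h] ; linarith
  have e : ∀ i : Fin (m + 3), i = 0 ∨ i = Fin.last (m + 2) ∨
      ∃ (k : ℕ) (hk : k < m + 1), i = ⟨k + 1, by omega⟩ := by
    intro i
    by_cases h1 : (i : ℕ) = 0
    · left; exact Fin.ext h1
    · by_cases h2 : (i : ℕ) = m + 2
      · right; left; exact Fin.ext h2
      · right; right
        exact ⟨(i : ℕ) - 1, by have := i.isLt; omega, by ext; simp; omega⟩
  have hle : ∀ i, x i ≤ y 0 + y 1 := by
    intro i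
    rcases e i with rfl | rfl | ⟨k, hk, rfl⟩
    · linarith
    · linarith
    · rw [hr k hk]; exact (hm _ _ (Fin.le_last _)).trans hyl
  have hge : ∀ i, x 0 ≤ x i := by
    intro i
    rcases e i with rfl | rfl | ⟨k, hk, rfl⟩
    · linarith
    · linarith
    · rw [hr k hk]
      refine hx0''.trans (hm _ _ ?_)
      rw [Fin.le_def]; simp
  refine ⟨hx0, ?_, ?_⟩
  · intro i j hij
    have hij' : (i : ℕ) ≤ j := hij
    rcases e i with rfl | rfl | ⟨k, hk, rfl⟩
    · exact hge j
    · have : j = Fin.last (m + 2) := le_antisymm (Fin.le_last _) hij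
      rw [this]
    · rcases e j with rfl | rfl | ⟨l, hl', rfl⟩
      · simp at hij'
      · rw [hl]; exact hle _
      · rw [hr k hk, hr l hl']
        apply hm
        rw [Fin.le_def]; simp at hij' ⊢; omega
  · rw [hl]
    have h1 : x 1 = y ⟨2, by omega⟩ := hr 0 (by omega)
    rw [h1]
    have : y 1 ≤ y ⟨2, by omega⟩ := hm _ _ (by rw [Fin.le_def]; simp)
    linarith

lemma B1_Om {m : ℕ} {y : Fin (m + 3) → ℝ} (hy : y ∈ Om m) : selmerB1 m *ᵥ y ∈ Om m := by
  refine B_Om_aux hy (Or.inl ?_) ?_ ?_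
  · rw [B1_mulVec]; simp
  · rw [B1_mulVec]; simp
  · intro i hi; rw [B1_mulVec, if_neg (by simp), dif_neg (by simp; omega)]

lemma B2_Om {m : ℕ} {y : Fin (m + 3) → ℝ} (hy : y ∈ Om m) : selmerB2 m *ᵥ y ∈ Om m := by
  refine B_Om_aux hy (Or.inr ?_) ?_ ?_
  · rw [B2_mulVec]; simp
  · rw [B2_mulVec]; simp
  · intro i hi; rw [B2_mulVec, if_neg (by simp), dif_neg (by simp; omega)]

lemma B1_branch {m : ℕ} {y : Fin (m + 3) → ℝ} (hy : y ∈ Om m) :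
    2 * (selmerB1 m *ᵥ y) 0 ≤ (selmerB1 m *ᵥ y) (Fin.last (m + 2)) := by
  have := Om_01 hy
  rw [B1_mulVec, B1_mulVec]; simp; linarith

lemma B2_branch {m : ℕ} {y : Fin (m + 3) → ℝ} (hy : y 0 < y 1) :
    ¬ 2 * (selmerB2 m *ᵥ y) 0 ≤ (selmerB2 m *ᵥ y) (Fin.last (m + 2)) := by
  rw [B2_mulVec, B2_mulVec]; simp; linarith

/-- column formulas -/
lemma vecMul_B1 (m : ℕ) (C : Fin (m + 3) → ℝ) (j : Fin (m + 3)) :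
    (C ᵥ* selmerB1 m) j = if (j : ℕ) = 0 then C 0 + C (Fin.last (m + 2))
      else if (j : ℕ) = 1 then C (Fin.last (m + 2))
      else C ⟨(j : ℕ) - 1, by have := j.isLt; omega⟩ := by
  simp only [vecMul, dotProduct, selmerB1, Matrix.of_apply]
  rw [Fin.sum_univ_succ, Fin.sum_univ_castSucc]
  have h : ∀ i : Fin (m + 1), (i : ℕ) ≠ m + 1 := fun i => by have := i.isLt; omega
  rcases j with ⟨_ | _ | k, hk⟩
  · simp [h]
  · simp [h]
  · simp only [Fin.val_zero, Fin.val_succ, Fin.val_castSucc, Fin.val_last, if_true, Fin.succ_last,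
      Nat.add_eq_zero_iff, one_ne_zero, and_false, if_false, Nat.add_right_cancel_iff, h]
    rw [Finset.sum_eq_single (⟨k, by omega⟩ : Fin (m + 1))]
    · simp
    · intro b _ hb
      rw [if_neg, mul_zero]
      intro hh; apply hb; exact Fin.ext (by simp; omega)
    · simp

lemma vecMul_B2 (m : ℕ) (C : Fin (m + 3) → ℝ) (j : Fin (m + 3)) :
    (C ᵥ* selmerB2 m) j = if (j : ℕ) = 0 then C (Fin.last (m + 2))
      else if (j : ℕ) = 1 then C 0 + C (Fin.last (m + 2))
      else C ⟨(j : ℕ) - 1, by have := j.isLt; omega⟩ := by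
  simp only [vecMul, dotProduct, selmerB2, Matrix.of_apply]
  rw [Fin.sum_univ_succ, Fin.sum_univ_castSucc]
  have h : ∀ i : Fin (m + 1), (i : ℕ) ≠ m + 1 := fun i => by have := i.isLt; omega
  rcases j with ⟨_ | _ | k, hk⟩
  · simp [h]
  · simp [h]
  · simp only [Fin.val_zero, Fin.val_succ, Fin.val_castSucc, Fin.val_last, if_true, Fin.succ_last,
      Nat.add_eq_zero_iff, one_ne_zero, and_false, if_false, Nat.add_right_cancel_iff, h]
    rw [Finset.sum_eq_single (⟨k, by omega⟩ : Fin (m + 1))]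
    · simp
    · intro b _ hb
      rw [if_neg, mul_zero]
      intro hh; apply hb; exact Fin.ext (by simp; omega)
    · simp

end SelmerAux

namespace SelmerAux

open Matrix

lemma det_B1 (m : ℕ) : |(selmerB1 m).det| = 1 := by
  rw [Matrix.det_succ_row_zero, Finset.sum_eq_single 0]
  · have h : (selmerB1 m).submatrix Fin.succ (Fin.succAbove 0) =
        ((finRotate (m + 2)).toPEquiv.toMatrix : Matrix (Fin (m + 2)) (Fin (m + 2)) ℝ) := by
      ext i j
      rw [PEquiv.toMatrix_apply]
      rcases Nat.lt_or_ge (i : ℕ) (m + 1) with hi | hi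
      · have e : ((finRotate (m + 2)) i : ℕ) = i + 1 := by
          rw [coe_finRotate_of_ne_last]
          intro h; rw [h] at hi; simp at hi
        have hne : (i : ℕ) ≠ m + 1 := by omega
        by_cases hij : (j : ℕ) = i + 1
        · have : finRotate (m + 2) i = j := Fin.ext (by omega)
          simp [selmerB1, hij, hne, this]
        · have : finRotate (m + 2) i ≠ j := fun h => hij (by rw [← h]; exact e)
          simp [selmerB1, hij, hne]
          simpa using this
      · have hil : i = Fin.last (m + 1) := le_antisymm (Fin.le_last _) hi
        subst hil
        by_cases hj : j = 0
        · subst hj; simp [selmerB1]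
        · have : (0 : Fin (m + 2)) ≠ j := fun h => hj h.symm
          simp [selmerB1, hj, this]
    rw [h, Matrix.det_permutation]
    have : (selmerB1 m) 0 0 = 1 := by simp [selmerB1]
    rw [this]
    rcases Int.units_eq_one_or (Equiv.Perm.sign (finRotate (m + 2))) with h | h <;> simp [h]
  · intro b _ hb
    have : (selmerB1 m) 0 b = 0 := by
      simp [selmerB1, hb]
    rw [this]; ring
  · simp

lemma B2_eq (m : ℕ) : selmerB2 m = (selmerB1 m).submatrix id (Equiv.swap 0 1) := by
  ext i j
  rcases j with ⟨_ | _ | k, hk⟩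
  · have : Equiv.swap (0 : Fin (m + 3)) 1 ⟨0, hk⟩ = 1 := Equiv.swap_apply_left _ _
    simp only [submatrix_apply, this]
    by_cases h0 : i = 0 <;> simp [selmerB1, selmerB2, h0]
  · have : Equiv.swap (0 : Fin (m + 3)) 1 ⟨0 + 1, hk⟩ = 0 := Equiv.swap_apply_right _ _
    simp only [submatrix_apply, this]
    by_cases h0 : i = 0 <;> simp [selmerB1, selmerB2, h0]
  · have : Equiv.swap (0 : Fin (m + 3)) 1 ⟨k + 1 + 1, hk⟩ = ⟨k + 1 + 1, hk⟩ :=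
      Equiv.swap_apply_of_ne_of_ne (by simp [Fin.ext_iff]) (by simp [Fin.ext_iff])
    simp only [submatrix_apply, this]
    simp [selmerB1, selmerB2]

lemma det_B2 (m : ℕ) : |(selmerB2 m).det| = 1 := by
  rw [B2_eq, Matrix.det_permute', abs_mul, det_B1]
  rcases Int.units_eq_one_or (Equiv.Perm.sign (Equiv.swap (0 : Fin (m + 3)) 1)) with h | h <;>
    simp [h]

lemma vol_image {m : ℕ} (B : Matrix (Fin (m + 3)) (Fin (m + 3)) ℝ)
    (A : Set (Fin (m + 3) → ℝ)) :
    volume ((fun y => B *ᵥ y) '' A) = ENNReal.ofReal |B.det| * volume A := by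
  have := MeasureTheory.Measure.addHaar_image_linearMap (volume : Measure (Fin (m + 3) → ℝ))
    (Matrix.toLin' B) A
  rw [LinearMap.det_toLin'] at this
  exact this

lemma vol_B1 {m : ℕ} (A : Set (Fin (m + 3) → ℝ)) :
    volume ((fun y => selmerB1 m *ᵥ y) '' A) = volume A := by
  rw [vol_image, det_B1]; simp

lemma vol_B2 {m : ℕ} (A : Set (Fin (m + 3) → ℝ)) :
    volume ((fun y => selmerB2 m *ᵥ y) '' A) = volume A := by
  rw [vol_image, det_B2]; simp

lemma meas_S (m : ℕ) : Measurable (selmerS m) := by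
  have hs : MeasurableSet {x : Fin (m + 3) → ℝ | 2 * x 0 ≤ x (Fin.last (m + 2))} :=
    measurableSet_le (by fun_prop) (by fun_prop)
  refine measurable_pi_lambda _ fun i => ?_
  unfold selmerS
  split_ifs
  · exact Measurable.ite hs (by fun_prop) (by fun_prop)
  · exact Measurable.ite hs (by fun_prop) (by fun_prop)
  · fun_prop

lemma meas_iter (m n : ℕ) : Measurable ((selmerS m)^[n]) := (meas_S m).iterate n

lemma meas_Om (m : ℕ) : MeasurableSet (Om m) := by
  have h1 : MeasurableSet {x : Fin (m + 3) → ℝ | 0 ≤ x 0} :=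
    measurableSet_le (by fun_prop) (by fun_prop)
  have h2 : MeasurableSet {x : Fin (m + 3) → ℝ | x (Fin.last (m + 2)) ≤ x 0 + x 1} :=
    measurableSet_le (by fun_prop) (by fun_prop)
  refine MeasurableSet.inter h1 (MeasurableSet.inter ?_ h2)
  have : {x : Fin (m + 3) → ℝ | ∀ i j : Fin (m + 3), i ≤ j → x i ≤ x j} =
      ⋂ i, ⋂ j, ⋂ (_ : i ≤ j), {x | x i ≤ x j} := by ext; simp
  change MeasurableSet {x : Fin (m + 3) → ℝ | ∀ i j : Fin (m + 3), i ≤ j → x i ≤ x j}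
  rw [this]
  exact MeasurableSet.iInter fun i => MeasurableSet.iInter fun j => MeasurableSet.iInter fun _ =>
    measurableSet_le (by fun_prop) (by fun_prop)

/-- Hyperplanes are null. -/
lemma hyper_null {m : ℕ} (f : (Fin (m + 3) → ℝ) →ₗ[ℝ] ℝ) (hf : f ≠ 0) :
    volume {x | f x = 0} = 0 := by
  have := MeasureTheory.Measure.addHaar_submodule (volume : Measure (Fin (m + 3) → ℝ))
    (LinearMap.ker f) (by rwa [Ne, LinearMap.ker_eq_top])
  exact this

lemma null_zero (m : ℕ) : volume {x : Fin (m + 3) → ℝ | x 0 = 0} = 0 := by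
  refine hyper_null (LinearMap.proj 0) ?_
  intro h
  have := congrArg (fun f => f (fun _ => 1)) h
  simp at this

lemma null_eq (m : ℕ) : volume {x : Fin (m + 3) → ℝ | x 0 = x 1} = 0 := by
  have := hyper_null (m := m) ((LinearMap.proj 0 : (Fin (m + 3) → ℝ) →ₗ[ℝ] ℝ) - LinearMap.proj 1) ?_
  · convert this using 3
    simp [sub_eq_zero]
  · intro h
    have := congrArg (fun f => f (Pi.single 0 1)) h
    simp at this

/-- points whose first coordinate is eventually zero -/
lemma null_Z (m : ℕ) (n : ℕ) : volume {x | x ∈ Om m ∧ (selmerS m)^[n] x 0 = 0} = 0 := by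
  induction n with
  | zero => exact measure_mono_null (fun x hx => hx.2) (null_zero m)
  | succ n ih =>
    refine measure_mono_null (t := ((fun y => selmerB1 m *ᵥ y) ''
      {x | x ∈ Om m ∧ (selmerS m)^[n] x 0 = 0}) ∪ ((fun y => selmerB2 m *ᵥ y) ''
      {x | x ∈ Om m ∧ (selmerS m)^[n] x 0 = 0})) ?_ ?_
    · rintro x ⟨hx, h⟩
      rw [Function.iterate_succ_apply] at h
      by_cases hb : 2 * x 0 ≤ x (Fin.last (m + 2))
      · exact Or.inl ⟨selmerS m x, ⟨S_Om hx, h⟩, B1_S m x hb⟩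
      · exact Or.inr ⟨selmerS m x, ⟨S_Om hx, h⟩, B2_S m x hb⟩
    · rw [measure_union_null_iff, vol_B1, vol_B2]; exact ⟨ih, ih⟩

lemma S_sum (m : ℕ) (x : Fin (m + 3) → ℝ) : ∑ i, selmerS m x i = ∑ i, x i - x 0 := by
  rw [Fin.sum_univ_succ, Fin.sum_univ_succ, Fin.sum_univ_castSucc (f := x)]
  have h1 : ∀ i : Fin (m + 1), selmerS m x i.succ.succ = x i.succ.castSucc := by
    intro i
    rw [S_big _ _ _ (by simp)]
    rfl
  simp only [h1]
  rw [Fin.sum_univ_succ (f := fun i : Fin (m + 2) => x i.castSucc)]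
  have h2 : selmerS m x 0 + selmerS m x (Fin.succ 0) = x (Fin.last (m + 2)) := by
    have : (Fin.succ 0 : Fin (m + 3)) = 1 := rfl
    rw [this, S_zero, S_one]; split_ifs <;> ring
  simp only [Fin.castSucc_zero]
  linarith

lemma Om_nonneg {m : ℕ} {x : Fin (m + 3) → ℝ} (hx : x ∈ Om m) (i) : 0 ≤ x i :=
  hx.1.trans (hx.2.1 _ _ (Fin.zero_le _))

lemma iter_sum {m : ℕ} {x : Fin (m + 3) → ℝ} (n : ℕ) :
    ∑ i, (selmerS m)^[n] x i = ∑ i, x i - ∑ k ∈ Finset.range n, (selmerS m)^[k] x 0 := by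
  induction n with
  | zero => simp
  | succ n ih => rw [Function.iterate_succ_apply', S_sum, ih, Finset.sum_range_succ]; ring

lemma first_tendsto {m : ℕ} {x : Fin (m + 3) → ℝ} (hx : x ∈ Om m) :
    Filter.Tendsto (fun n => (selmerS m)^[n] x 0) Filter.atTop (nhds 0) := by
  apply Summable.tendsto_atTop_zero
  refine summable_of_sum_range_le (c := ∑ i, x i) (fun n => (iter_Om hx n).1) fun n => ?_
  have := iter_sum (m := m) (x := x) n
  have h2 : 0 ≤ ∑ i, (selmerS m)^[n] x i :=
    Finset.sum_nonneg fun i _ => Om_nonneg (iter_Om hx n) i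
  linarith

lemma second_small {m : ℕ} {x : Fin (m + 3) → ℝ} (hx : x ∈ Om m)
    (hpos : ∀ n, (selmerS m)^[n] x 0 ≠ 0) {δ : ℝ} (hδ : 0 < δ) :
    ∃ n, (selmerS m)^[n] x 1 < δ := by
  have ht := first_tendsto hx
  obtain ⟨n0, hn0⟩ := (ht.eventually (gt_mem_nhds hδ)).exists_forall_of_atTop
  by_cases hex : ∃ n ≥ n0, ¬ 2 * (selmerS m)^[n] x 0 ≤ (selmerS m)^[n] x (Fin.last (m + 2))
  · obtain ⟨n, hn, hb⟩ := hex
    refine ⟨n + 1, ?_⟩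
    rw [Function.iterate_succ_apply', S_one, if_neg hb]
    exact hn0 n hn
  · push Not at hex
    exfalso
    have hc : ∀ k, (selmerS m)^[n0 + k] x 0 = (selmerS m)^[n0] x 0 := by
      intro k
      induction k with
      | zero => rfl
      | succ k ih =>
        rw [← add_assoc, Function.iterate_succ_apply', S_zero, if_pos (hex _ (by omega)), ih]
    have h1 : Filter.Tendsto (fun k => (selmerS m)^[n0 + k] x 0) Filter.atTop (nhds 0) :=
      ht.comp (Filter.tendsto_atTop_mono (fun k => Nat.le_add_left k n0) Filter.tendsto_id)
    simp only [hc] at h1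
    exact hpos n0 (tendsto_nhds_unique tendsto_const_nhds h1)

lemma iter_second_anti {m : ℕ} {x : Fin (m + 3) → ℝ} (hx : x ∈ Om m) :
    Antitone (fun n => (selmerS m)^[n] x 1) := by
  apply antitone_nat_of_succ_le
  intro n
  rw [Function.iterate_succ_apply']
  exact S_one_le (iter_Om hx n)

lemma S_smul {m : ℕ} (x : Fin (m + 3) → ℝ) {t : ℝ} (ht : 0 < t) :
    selmerS m (t • x) = t • selmerS m x := by
  have h : (2 * (t * x 0) ≤ t * x (Fin.last (m + 2))) ↔ 2 * x 0 ≤ x (Fin.last (m + 2)) := by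
    rw [show 2 * (t * x 0) = t * (2 * x 0) by ring]
    exact mul_le_mul_iff_right₀ ht
  ext i
  simp only [selmerS, Pi.smul_apply, smul_eq_mul, h]
  split_ifs <;> ring

lemma iter_smul {m : ℕ} (x : Fin (m + 3) → ℝ) {t : ℝ} (ht : 0 < t) (n : ℕ) :
    (selmerS m)^[n] (t • x) = t • (selmerS m)^[n] x := by
  induction n with
  | zero => rfl
  | succ n ih => rw [Function.iterate_succ_apply', ih, S_smul _ ht, Function.iterate_succ_apply']

lemma Om_smul {m : ℕ} {x : Fin (m + 3) → ℝ} (hx : x ∈ Om m) {t : ℝ} (ht : 0 < t) :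
    t • x ∈ Om m := by
  obtain ⟨h0, hm, hl⟩ := hx
  refine ⟨by simp; positivity, fun i j hij => ?_, ?_⟩
  · simp only [Pi.smul_apply, smul_eq_mul]
    exact mul_le_mul_of_nonneg_left (hm i j hij) ht.le
  · simp only [Pi.smul_apply, smul_eq_mul]
    rw [← mul_add]
    exact mul_le_mul_of_nonneg_left hl ht.le

end SelmerAux

namespace SelmerAux

open Matrix
open scoped ENNReal

/-- Volume of the truncated cone. -/
noncomputable def V {m : ℕ} (C : Fin (m + 3) → ℝ) (U : Set (Fin (m + 3) → ℝ)) : ℝ≥0∞ :=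
  volume {x | x ∈ Om m ∧ x ∈ U ∧ C ⬝ᵥ x ≤ 1}

/-- the set where the second coordinate has become small after `k` steps -/
def W (m : ℕ) (ε : ℝ) (k : ℕ) : Set (Fin (m + 3) → ℝ) :=
  {x | (selmerS m)^[k] x 1 < ε * x 0}

lemma meas_W (m : ℕ) (ε : ℝ) (k : ℕ) : MeasurableSet (W m ε k) := by
  refine measurableSet_lt ?_ (by fun_prop)
  exact (measurable_pi_apply 1).comp (meas_iter m k)

lemma W_smul {m : ℕ} {ε : ℝ} {k : ℕ} {x : Fin (m + 3) → ℝ} {t : ℝ} (ht : 0 < t) :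
    t • x ∈ W m ε k ↔ x ∈ W m ε k := by
  simp only [W, Set.mem_ofPred_eq, iter_smul x ht, Pi.smul_apply, smul_eq_mul]
  rw [show ε * (t * x 0) = t * (ε * x 0) by ring]
  exact mul_lt_mul_iff_right₀ ht

lemma scale_aux {m : ℕ} (U : Set (Fin (m + 3) → ℝ))
    (hU : ∀ x, ∀ t : ℝ, 0 < t → x ∈ U → t • x ∈ U) {r : ℝ} (hr : 0 < r) :
    volume {x | x ∈ Om m ∧ x ∈ U ∧ x 1 ≤ r} =
      ENNReal.ofReal (r ^ (m + 3)) * volume {x | x ∈ Om m ∧ x ∈ U ∧ x 1 ≤ 1} := by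
  have h := MeasureTheory.Measure.addHaar_smul (volume : Measure (Fin (m + 3) → ℝ)) r
    {x | x ∈ Om m ∧ x ∈ U ∧ x 1 ≤ 1}
  rw [Module.finrank_fin_fun, abs_of_pos (by positivity)] at h
  rw [← h]
  congr 1
  ext x
  rw [Set.mem_smul_set_iff_inv_smul_mem₀ hr.ne']
  have hr' : 0 < r⁻¹ := by positivity
  have e : r • r⁻¹ • x = x := smul_inv_smul₀ hr.ne' x
  constructor
  · rintro ⟨h1, h2, h3⟩
    refine ⟨Om_smul h1 hr', hU _ _ hr' h2, ?_⟩
    simp only [Pi.smul_apply, smul_eq_mul]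
    rw [inv_mul_le_iff₀ hr]; linarith
  · rintro ⟨h1, h2, h3⟩
    refine ⟨?_, ?_, ?_⟩
    · rw [← e]; exact Om_smul h1 hr
    · rw [← e]; exact hU _ _ hr h2
    · simp only [Pi.smul_apply, smul_eq_mul] at h3
      rw [inv_mul_le_iff₀ hr] at h3; linarith

lemma box_fin (m : ℕ) (r : ℝ) :
    volume {x : Fin (m + 3) → ℝ | x ∈ Om m ∧ x 1 ≤ r} < ∞ := by
  refine lt_of_le_of_lt (measure_mono (t := Set.Icc 0 (fun _ => 2 * r)) ?_)
    (isCompact_Icc.measure_lt_top)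
  rintro x ⟨hx, h1⟩
  refine ⟨fun i => Om_nonneg hx i, fun i => ?_⟩
  have := hx.2.1 i _ (Fin.le_last i)
  have h2 := hx.2.2
  have h3 := Om_01 hx
  show x i ≤ 2 * r
  linarith

lemma T_pos (m : ℕ) : 0 < volume {x : Fin (m + 3) → ℝ | x ∈ Om m ∧ x 1 ≤ 1} := by
  have hopen : IsOpen {x : Fin (m + 3) → ℝ | 0 < x 0 ∧ (∀ i j : Fin (m + 3), i < j → x i < x j) ∧
      x (Fin.last (m + 2)) < x 0 + x 1 ∧ x 1 < 1} := by
    refine IsOpen.inter (isOpen_lt (f := fun _ => (0 : ℝ))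
      (g := fun x : Fin (m + 3) → ℝ => x 0) (by fun_prop) (by fun_prop)) ?_
    refine IsOpen.inter ?_ (IsOpen.inter
      (isOpen_lt (f := fun x : Fin (m + 3) → ℝ => x (Fin.last (m + 2))) (by fun_prop) (by fun_prop))
      (isOpen_lt (f := fun x : Fin (m + 3) → ℝ => x 1) (by fun_prop) (by fun_prop)))
    have : {x : Fin (m + 3) → ℝ | ∀ i j : Fin (m + 3), i < j → x i < x j} =
      ⋂ i, ⋂ j, {x | i < j → x i < x j} := by ext; simp
    change IsOpen {x : Fin (m + 3) → ℝ | ∀ i j : Fin (m + 3), i < j → x i < x j}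
    rw [this]
    refine isOpen_iInter_of_finite fun i => isOpen_iInter_of_finite fun j => ?_
    by_cases hij : i < j
    · simp only [hij, forall_const]
      exact isOpen_lt (by fun_prop) (by fun_prop)
    · simp [hij]
  refine lt_of_lt_of_le (hopen.measure_pos volume ?_) (measure_mono ?_)
  · have hm : (0 : ℝ) < (m : ℝ) + 3 := by positivity
    refine ⟨fun i => 1 / 2 + (i : ℕ) / (8 * ((m : ℝ) + 3)), ?_, ?_, ?_, ?_⟩
    · simp
    · intro i j hij
      have : ((i : ℕ) : ℝ) < (j : ℕ) := by exact_mod_cast hij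
      show 1 / 2 + ((i : ℕ) : ℝ) / (8 * ((m : ℝ) + 3)) < 1 / 2 + ((j : ℕ) : ℝ) / (8 * ((m : ℝ) + 3))
      gcongr
    · have h1 : ((m : ℝ) + 2) / (8 * ((m : ℝ) + 3)) < 1 / 2 := by
        rw [div_lt_div_iff₀ (by positivity) (by positivity)]; nlinarith
      have h2 : 0 < (8 * ((m : ℝ) + 3)) := by positivity
      simp
      have h3 : (((m : ℝ) + 3))⁻¹ * 8⁻¹ > 0 := by positivity
      linarith
    · have h1 : (1 : ℝ) / (8 * ((m : ℝ) + 3)) < 1 / 2 := by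
        rw [div_lt_div_iff₀ (by positivity) (by positivity)]; nlinarith [(Nat.cast_nonneg m : (0:ℝ) ≤ m)]
      simp only [Fin.val_one, Nat.cast_one]
      linarith
  · rintro x ⟨h0, h1, h2, h3⟩
    refine ⟨⟨h0.le, fun i j hij => ?_, h2.le⟩, h3.le⟩
    rcases hij.lt_or_eq with h | h
    · exact (h1 i j h).le
    · rw [h]

lemma F_tendsto (m : ℕ) {ε : ℝ} (hε : 0 < ε) :
    Filter.Tendsto (fun k => volume {x | x ∈ Om m ∧ x ∈ (W m ε k)ᶜ ∧ x 1 ≤ 1})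
      Filter.atTop (nhds 0) := by
  have hnull : volume (⋂ k, {x | x ∈ Om m ∧ x ∈ (W m ε k)ᶜ ∧ x 1 ≤ 1}) = 0 := by
    refine measure_mono_null (t := ⋃ n, {x | x ∈ Om m ∧ (selmerS m)^[n] x 0 = 0}) ?_
      (measure_iUnion_null fun n => null_Z m n)
    intro x hx
    rw [Set.mem_iInter] at hx
    by_contra hcon
    simp only [Set.mem_iUnion, Set.mem_ofPred_eq, not_exists, not_and] at hcon
    have hO := (hx 0).1
    have hpos : ∀ n, (selmerS m)^[n] x 0 ≠ 0 := fun n => hcon n hO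
    have h0 : 0 < x 0 := lt_of_le_of_ne hO.1 (fun h => hpos 0 h.symm)
    obtain ⟨n, hn⟩ := second_small hO hpos (mul_pos hε h0)
    exact (hx n).2.1 hn
  rw [← hnull]
  apply tendsto_measure_iInter_atTop
  · intro k
    refine ((meas_Om m).inter ((meas_W m ε k).compl.inter ?_)).nullMeasurableSet
    exact measurableSet_le (f := fun x : Fin (m + 3) → ℝ => x 1) (g := fun _ => (1 : ℝ))
      (by fun_prop) (by fun_prop)
  · intro k l hkl x hx
    refine ⟨hx.1, fun h => hx.2.1 ?_, hx.2.2⟩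
    exact lt_of_le_of_lt (iter_second_anti hx.1 hkl) h
  · exact ⟨0, (lt_of_le_of_lt (measure_mono
      (t := {x : Fin (m + 3) → ℝ | x ∈ Om m ∧ x 1 ≤ 1}) fun x hx => ⟨hx.1, hx.2.2⟩) (box_fin m 1)).ne⟩

/-- Sum of the weights other than the first. -/
noncomputable def Sg {m : ℕ} (C : Fin (m + 3) → ℝ) : ℝ := ∑ j : Fin (m + 2), C j.succ

lemma Sg_pos {m : ℕ} {C : Fin (m + 3) → ℝ} (hC : ∀ j, 0 < C j) : 0 < Sg C :=
  Finset.sum_pos (fun _ _ => hC _) Finset.univ_nonempty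

lemma dot_lower {m : ℕ} {C x : Fin (m + 3) → ℝ} (hC : ∀ j, 0 < C j) (hx : x ∈ Om m) :
    C 0 * x 0 + Sg C * x 1 ≤ C ⬝ᵥ x := by
  rw [dotProduct, Fin.sum_univ_succ, Sg, Finset.sum_mul]
  gcongr with j
  · exact (hC _).le
  · apply hx.2.1
    rw [Fin.le_def]; simp

lemma dot_upper {m : ℕ} {C x : Fin (m + 3) → ℝ} (hC : ∀ j, 0 < C j) (hx : x ∈ Om m) :
    C ⬝ᵥ x ≤ C 0 * x 0 + Sg C * (x 0 + x 1) := by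
  rw [dotProduct, Fin.sum_univ_succ, Sg, Finset.sum_mul]
  gcongr with j
  · exact (hC _).le
  · exact (hx.2.1 _ _ (Fin.le_last _)).trans hx.2.2

lemma V_fin {m : ℕ} {C : Fin (m + 3) → ℝ} (hC : ∀ j, 0 < C j) (U) : V C U < ∞ := by
  have hS := Sg_pos hC
  refine lt_of_le_of_lt (measure_mono ?_) (box_fin m (1 / Sg C))
  rintro x ⟨hx, -, h⟩
  refine ⟨hx, ?_⟩
  have := dot_lower hC hx
  have h0 := mul_nonneg (hC 0).le hx.1
  rw [le_div_iff₀ hS]; linarith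

lemma V_mono {m : ℕ} (C : Fin (m + 3) → ℝ) {U U' : Set (Fin (m + 3) → ℝ)}
    (h : U ⊆ U') : V C U ≤ V C U' :=
  measure_mono fun _ hx => ⟨hx.1, h hx.2.1, hx.2.2⟩

lemma V_pos {m : ℕ} {C : Fin (m + 3) → ℝ} (hC : ∀ j, 0 < C j) : 0 < V C Set.univ := by
  have hS := Sg_pos hC
  have h0 := hC 0
  have hT := T_pos m
  have hr : 0 < 1 / (C 0 + 2 * Sg C) := by positivity
  have h := scale_aux (m := m) Set.univ (fun _ _ _ _ => trivial) hr
  simp only [Set.mem_univ, true_and] at h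
  have : 0 < volume {x : Fin (m + 3) → ℝ | x ∈ Om m ∧ x 1 ≤ 1 / (C 0 + 2 * Sg C)} := by
    rw [h]
    exact ENNReal.mul_pos (by simp; positivity) hT.ne'
  refine this.trans_le (measure_mono ?_)
  rintro x ⟨hx, h1⟩
  refine ⟨hx, trivial, ?_⟩
  have := dot_upper hC hx
  have h01 := Om_01 hx
  rw [le_div_iff₀ (by positivity)] at h1
  nlinarith

lemma good_est (m : ℕ) {ε : ℝ} (hε : 0 < ε) {η : ℝ} (hη : 0 < η) :
    ∃ k, ∀ C : Fin (m + 3) → ℝ, (∀ j, 0 < C j) → C 0 ≤ C 1 →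
      V C (W m ε k)ᶜ ≤ ENNReal.ofReal η * V C Set.univ := by
  have hT := T_pos m
  set T := volume {x : Fin (m + 3) → ℝ | x ∈ Om m ∧ x 1 ≤ 1} with hTdef
  have hpos : 0 < ENNReal.ofReal (η * (1 / 3) ^ (m + 3)) * T :=
    ENNReal.mul_pos (by simp; positivity) hT.ne'
  obtain ⟨k, hk⟩ := ((F_tendsto m hε).eventually (gt_mem_nhds hpos)).exists
  refine ⟨k, fun C hC h01 => ?_⟩
  have hS := Sg_pos hC
  have hC1 : C 1 ≤ Sg C :=
    Finset.single_le_sum (f := fun j : Fin (m + 2) => C j.succ) (fun j _ => (hC _).le)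
      (Finset.mem_univ 0)
  have hup : V C (W m ε k)ᶜ ≤ volume {x | x ∈ Om m ∧ x ∈ (W m ε k)ᶜ ∧ x 1 ≤ 1 / Sg C} := by
    refine measure_mono ?_
    rintro x ⟨hx, hw, h⟩
    refine ⟨hx, hw, ?_⟩
    have := dot_lower hC hx
    have h0 := mul_nonneg (hC 0).le hx.1
    rw [le_div_iff₀ hS]; linarith
  rw [scale_aux _ (fun x t ht hx => by
    rw [Set.mem_compl_iff, W_smul ht]; exact hx) (by positivity)] at hup
  have hlo : volume {x : Fin (m + 3) → ℝ | x ∈ Om m ∧ x ∈ Set.univ ∧ x 1 ≤ 1 / (3 * Sg C)} ≤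
      V C Set.univ := by
    refine measure_mono ?_
    rintro x ⟨hx, -, h1⟩
    refine ⟨hx, trivial, ?_⟩
    have h3 := dot_upper hC hx
    have h4 := Om_01 hx
    have h5 := hx.1
    rw [le_div_iff₀ (by positivity)] at h1
    have h6 : C 0 * x 0 ≤ Sg C * x 1 := by
      apply mul_le_mul (h01.trans hC1) h4 h5 hS.le
    nlinarith
  rw [scale_aux Set.univ (fun _ _ _ _ => trivial) (by positivity)] at hlo
  simp only [Set.mem_univ, true_and] at hlo
  rw [← hTdef] at hlo
  calc V C (W m ε k)ᶜ ≤ _ := hup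
    _ ≤ ENNReal.ofReal ((1 / Sg C) ^ (m + 3)) * (ENNReal.ofReal (η * (1 / 3) ^ (m + 3)) * T) := by
        gcongr
    _ = ENNReal.ofReal η * (ENNReal.ofReal ((1 / (3 * Sg C)) ^ (m + 3)) * T) := by
        rw [← mul_assoc, ← mul_assoc, ← ENNReal.ofReal_mul (by positivity),
          ← ENNReal.ofReal_mul (by positivity)]
        congr 2
        rw [show 1 / (3 * Sg C) = 1 / 3 * (1 / Sg C) by field_simp, mul_pow]; ring
    _ ≤ _ := by gcongr

end SelmerAux

namespace SelmerAux

open Matrix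
open scoped ENNReal

noncomputable def uvec (m : ℕ) (κ : ℝ) : Fin (m + 3) → ℝ := fun i => if i = 0 then 0 else (1 - κ) / κ
noncomputable def phi (m : ℕ) : Fin (m + 3) → ℝ := Pi.single 1 1 - Pi.single 0 1
noncomputable def Rmat (m : ℕ) (κ : ℝ) : Matrix (Fin (m + 3)) (Fin (m + 3)) ℝ :=
  κ • (1 + replicateCol Unit (uvec m κ) * replicateRow Unit (phi m))

lemma phi_dot (m : ℕ) (x : Fin (m + 3) → ℝ) : phi m ⬝ᵥ x = x 1 - x 0 := by
  rw [phi, sub_dotProduct, single_dotProduct, single_dotProduct]; ring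

lemma det_R (m : ℕ) {κ : ℝ} (hκ : 0 < κ) : (Rmat m κ).det = κ ^ (m + 2) := by
  rw [Rmat, det_smul, det_one_add_replicateCol_mul_replicateRow, phi_dot]
  simp [uvec]
  field_simp
  ring

lemma R_apply (m : ℕ) {κ : ℝ} (hκ : 0 < κ) (x : Fin (m + 3) → ℝ) (i : Fin (m + 3)) :
    (Rmat m κ *ᵥ x) i = if i = 0 then κ * x 0 else κ * x i + (1 - κ) * (x 1 - x 0) := by
  have : (replicateCol Unit (uvec m κ) * replicateRow Unit (phi m)) *ᵥ x =
      (phi m ⬝ᵥ x) • uvec m κ := by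
    ext i
    simp only [mulVec, dotProduct, Matrix.mul_apply, replicateCol_apply, replicateRow_apply, Finset.univ_unique, Finset.sum_singleton, Pi.smul_apply, smul_eq_mul]
    rw [Finset.sum_mul]
    exact Finset.sum_congr rfl fun _ _ => by ring
  rw [Rmat, smul_mulVec, add_mulVec, one_mulVec, this, phi_dot]
  simp only [Pi.smul_apply, Pi.add_apply, smul_eq_mul, uvec]
  split_ifs with h
  · rw [h]; ring
  · field_simp

lemma R_Om {m : ℕ} {κ : ℝ} (hκ : 1 ≤ κ) {x : Fin (m + 3) → ℝ} (hx : x ∈ Om m) :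
    Rmat m κ *ᵥ x ∈ Om m := by
  have hκ0 : 0 < κ := by linarith
  have h01 := Om_01 hx
  obtain ⟨h0, hm, hl⟩ := hx
  refine ⟨?_, ?_, ?_⟩
  · rw [R_apply m hκ0, if_pos rfl]; positivity
  · intro i j hij
    rw [R_apply m hκ0, R_apply m hκ0]
    split_ifs with h1 h2 h2
    · exact le_rfl
    · have : x 1 ≤ x j := hm _ _ (by
        rw [Fin.le_def, Fin.val_one]
        have : (j : ℕ) ≠ 0 := fun h => h2 (Fin.ext h)
        omega)
      nlinarith
    · exfalso; apply h1
      rw [h2] at hij; exact le_antisymm hij (Fin.zero_le _)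
    · have := hm i j hij
      nlinarith
  · rw [R_apply m hκ0, R_apply m hκ0, R_apply m hκ0, if_pos rfl, if_neg (by simp [Fin.ext_iff]),
      if_neg (by simp)]
    nlinarith

lemma R_dot {m : ℕ} {κ : ℝ} (hκ : 1 ≤ κ) (C x : Fin (m + 3) → ℝ) :
    C ⬝ᵥ (Rmat m κ *ᵥ x) = κ * (C ⬝ᵥ x) - (κ - 1) * (x 1 - x 0) * Sg C := by
  have hκ0 : 0 < κ := by linarith
  have h : ∀ c y : Fin (m + 3) → ℝ, c ⬝ᵥ y = c 0 * y 0 + ∑ j : Fin (m + 2), c j.succ * y j.succ :=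
    fun c y => by rw [dotProduct, Fin.sum_univ_succ]
  have this : ∀ j : Fin (m + 2), (Rmat m κ *ᵥ x) j.succ = κ * x j.succ + (1 - κ) * (x 1 - x 0) := by
    intro j; rw [R_apply m hκ0, if_neg (Fin.succ_ne_zero j)]
  have e2 : ∀ j : Fin (m + 2), C j.succ * (κ * x j.succ + (1 - κ) * (x 1 - x 0)) =
      κ * (C j.succ * x j.succ) + (1 - κ) * (x 1 - x 0) * C j.succ := by
    intro; ring
  rw [h, h, R_apply m hκ0, if_pos rfl]
  simp only [this, e2, Finset.sum_add_distrib, ← Finset.mul_sum]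
  rw [Sg]; ring

lemma tail_est {m : ℕ} {κ : ℝ} (hκ : 1 ≤ κ) {C C' : Fin (m + 3) → ℝ} (hC : ∀ j, 0 < C j)
    (hC' : ∀ j, 0 < C' j) (hS : Sg C' = Sg C) (h : κ * (C 0 + 2 * Sg C) ≤ C' 0) :
    ENNReal.ofReal κ * V C' Set.univ ≤ V C Set.univ := by
  have hκ0 : 0 < κ := by linarith
  have h1 : (fun y => Rmat m κ *ᵥ y) '' {x | x ∈ Om m ∧ x ∈ Set.univ ∧ C' ⬝ᵥ x ≤ 1} ⊆
      {x | x ∈ Om m ∧ x ∈ Set.univ ∧ C ⬝ᵥ x ≤ 1} := by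
    rintro _ ⟨x, ⟨hx, -, hd⟩, rfl⟩
    refine ⟨R_Om hκ hx, trivial, ?_⟩
    show C ⬝ᵥ (Rmat m κ *ᵥ x) ≤ 1
    rw [R_dot hκ]
    have a1 := dot_lower hC' hx
    have a2 := dot_upper hC hx
    have a3 := hx.1
    rw [hS] at a1
    have a4 : κ * (C 0 + 2 * Sg C) * x 0 ≤ C' 0 * x 0 := by gcongr
    have a5 : κ * (C ⬝ᵥ x) ≤ κ * (C 0 * x 0 + Sg C * (x 0 + x 1)) := by gcongr
    nlinarith [mul_nonneg (Sg_pos hC).le a3]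
  have h2 := measure_mono (μ := volume) h1
  rw [vol_image, det_R m hκ0, abs_of_pos (by positivity)] at h2
  refine le_trans ?_ h2
  show ENNReal.ofReal κ * V C' Set.univ ≤ ENNReal.ofReal (κ ^ (m + 2)) * V C' Set.univ
  gcongr
  exact le_self_pow₀ hκ (by omega)

/-- the first-branch region -/
def Br (m : ℕ) : Set (Fin (m + 3) → ℝ) := {x | 2 * x 0 ≤ x (Fin.last (m + 2))}

lemma meas_Br (m : ℕ) : MeasurableSet (Br m) :=
  measurableSet_le (by fun_prop) (by fun_prop)

lemma Br_smul {m : ℕ} {x : Fin (m + 3) → ℝ} {t : ℝ} (ht : 0 < t) :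
    t • x ∈ Br m ↔ x ∈ Br m := by
  simp only [Br, Set.mem_ofPred_eq, Pi.smul_apply, smul_eq_mul]
  rw [show 2 * (t * x 0) = t * (2 * x 0) by ring]
  exact mul_le_mul_iff_right₀ ht

lemma pull1 {m : ℕ} (C : Fin (m + 3) → ℝ) (U U' : Set (Fin (m + 3) → ℝ))
    (h : ∀ x ∈ Om m, x ∈ U → x ∈ Br m ∧ selmerS m x ∈ U') :
    V C U ≤ V (C ᵥ* selmerB1 m) U' := by
  refine le_trans (measure_mono ?_) (vol_B1 _).le
  rintro x ⟨hx, hU, hd⟩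
  obtain ⟨hb, hU'⟩ := h x hx hU
  have e := B1_S m x hb
  refine ⟨selmerS m x, ⟨S_Om hx, hU', ?_⟩, e⟩
  rw [← dotProduct_mulVec, e]; exact hd

lemma pull2 {m : ℕ} (C : Fin (m + 3) → ℝ) (U U' : Set (Fin (m + 3) → ℝ))
    (h : ∀ x ∈ Om m, x ∈ U → x ∉ Br m ∧ selmerS m x ∈ U') :
    V C U ≤ V (C ᵥ* selmerB2 m) U' := by
  refine le_trans (measure_mono ?_) (vol_B2 _).le
  rintro x ⟨hx, hU, hd⟩
  obtain ⟨hb, hU'⟩ := h x hx hU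
  have e := B2_S m x hb
  refine ⟨selmerS m x, ⟨S_Om hx, hU', ?_⟩, e⟩
  rw [← dotProduct_mulVec, e]; exact hd

lemma V_split {m : ℕ} (C : Fin (m + 3) → ℝ) :
    V (C ᵥ* selmerB1 m) Set.univ + V (C ᵥ* selmerB2 m) Set.univ ≤ V C Set.univ := by
  have h1 : V (C ᵥ* selmerB1 m) Set.univ ≤
      volume ({x | x ∈ Om m ∧ x ∈ Set.univ ∧ C ⬝ᵥ x ≤ 1} ∩ Br m) := by
    rw [V, ← vol_B1]
    refine measure_mono ?_
    rintro _ ⟨y, ⟨hy, -, hd⟩, rfl⟩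
    refine ⟨⟨B1_Om hy, trivial, ?_⟩, B1_branch hy⟩
    rw [dotProduct_mulVec]; exact hd
  have h2 : V (C ᵥ* selmerB2 m) Set.univ ≤
      volume ({x | x ∈ Om m ∧ x ∈ Set.univ ∧ C ⬝ᵥ x ≤ 1} \ Br m) := by
    have : V (C ᵥ* selmerB2 m) Set.univ ≤
        volume {y | y ∈ Om m ∧ y 0 < y 1 ∧ (C ᵥ* selmerB2 m) ⬝ᵥ y ≤ 1} +
        volume {x : Fin (m + 3) → ℝ | x 0 = x 1} := by
      refine le_trans (measure_mono ?_) (measure_union_le _ _)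
      rintro y ⟨hy, -, hd⟩
      rcases (Om_01 hy).lt_or_eq with h | h
      · exact Or.inl ⟨hy, h, hd⟩
      · exact Or.inr h
    rw [null_eq, add_zero] at this
    refine this.trans ?_
    rw [← vol_B2]
    refine measure_mono ?_
    rintro _ ⟨y, ⟨hy, hlt, hd⟩, rfl⟩
    refine ⟨⟨B2_Om hy, trivial, ?_⟩, B2_branch hlt⟩
    rw [dotProduct_mulVec]; exact hd
  calc _ ≤ _ := add_le_add h1 h2
    _ = _ := measure_inter_add_sdiff _ (meas_Br m)

/-- all of the first `K` steps are of type 1 -/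
def R (m K : ℕ) : Set (Fin (m + 3) → ℝ) := {x | ∀ j < K, (selmerS m)^[j] x ∈ Br m}
/-- the bad set -/
def Q (m : ℕ) (ε : ℝ) (k K : ℕ) : Set (Fin (m + 3) → ℝ) :=
  {x | ∃ n < K, x ∈ R m n ∧ (selmerS m)^[n] x ∉ Br m ∧ (selmerS m)^[n + 1] x ∉ W m ε k}

lemma meas_R (m K : ℕ) : MeasurableSet (R m K) := by
  have : R m K = ⋂ j, ⋂ (_ : j < K), (selmerS m)^[j] ⁻¹' Br m := by
    ext; simp [R]
  rw [this]
  exact MeasurableSet.iInter fun j => MeasurableSet.iInter fun _ => meas_iter m j (meas_Br m)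

lemma meas_Q (m : ℕ) (ε : ℝ) (k K : ℕ) : MeasurableSet (Q m ε k K) := by
  have : Q m ε k K = ⋃ n, ⋃ (_ : n < K), (R m n ∩ (((selmerS m)^[n] ⁻¹' Br m)ᶜ ∩
      ((selmerS m)^[n + 1] ⁻¹' W m ε k)ᶜ)) := by
    ext; simp only [Q, Set.mem_ofPred_eq, Set.mem_iUnion, Set.mem_inter_iff, Set.mem_compl_iff, Set.mem_preimage, exists_prop]
  rw [this]
  exact MeasurableSet.iUnion fun n => MeasurableSet.iUnion fun _ => (meas_R m n).inter
    ((meas_iter m n (meas_Br m)).compl.inter (meas_iter m (n + 1) (meas_W m ε k)).compl)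

lemma R_smul {m K : ℕ} {x : Fin (m + 3) → ℝ} {t : ℝ} (ht : 0 < t) :
    t • x ∈ R m K ↔ x ∈ R m K := by
  simp only [R, Set.mem_ofPred_eq, iter_smul x ht, Br_smul ht]

lemma Q_smul {m : ℕ} {ε : ℝ} {k K : ℕ} {x : Fin (m + 3) → ℝ} {t : ℝ} (ht : 0 < t) :
    t • x ∈ Q m ε k K ↔ x ∈ Q m ε k K := by
  simp only [Q, Set.mem_ofPred_eq, iter_smul x ht, Br_smul ht, R_smul ht, W_smul ht]

lemma vecMul_B1_pos {m : ℕ} {C : Fin (m + 3) → ℝ} (hC : ∀ j, 0 < C j) (j) :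
    0 < (C ᵥ* selmerB1 m) j := by
  rw [vecMul_B1]
  split_ifs
  · exact add_pos (hC _) (hC _)
  · exact hC _
  · exact hC _

lemma vecMul_B2_pos {m : ℕ} {C : Fin (m + 3) → ℝ} (hC : ∀ j, 0 < C j) (j) :
    0 < (C ᵥ* selmerB2 m) j := by
  rw [vecMul_B2]
  split_ifs
  · exact hC _
  · exact add_pos (hC _) (hC _)
  · exact hC _

lemma V_R {m : ℕ} (K : ℕ) (C : Fin (m + 3) → ℝ) :
    V C (R m K) ≤ V ((fun c => c ᵥ* selmerB1 m)^[K] C) Set.univ := by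
  induction K generalizing C with
  | zero => exact V_mono _ (Set.subset_univ _)
  | succ K ih =>
    rw [Function.iterate_succ_apply]
    refine (pull1 C _ (R m K) ?_).trans (ih _)
    intro x _ hR
    refine ⟨hR 0 (by omega), fun j hj => ?_⟩
    rw [← Function.iterate_succ_apply]
    exact hR (j + 1) (by omega)

lemma V_union {m : ℕ} (C : Fin (m + 3) → ℝ) {U U1 U2 : Set (Fin (m + 3) → ℝ)}
    (h : U ⊆ U1 ∪ U2) : V C U ≤ V C U1 + V C U2 := by
  refine le_trans (measure_mono ?_) (measure_union_le _ _)
  rintro x ⟨hx, hU, hd⟩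
  rcases h hU with h | h
  · exact Or.inl ⟨hx, h, hd⟩
  · exact Or.inr ⟨hx, h, hd⟩

lemma V_Q {m : ℕ} {ε : ℝ} {k : ℕ} {η : ℝ≥0∞} (hk : ∀ C : Fin (m + 3) → ℝ, (∀ j, 0 < C j) →
      C 0 ≤ C 1 → V C (W m ε k)ᶜ ≤ η * V C Set.univ) (K : ℕ)
    (C : Fin (m + 3) → ℝ) (hC : ∀ j, 0 < C j) :
    V C (Q m ε k K) ≤ η * V C Set.univ := by
  induction K generalizing C with
  | zero =>
    have : Q m ε k 0 = ∅ := by ext; simp [Q]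
    rw [this]; simp [V]
  | succ K ih =>
    have hsub : Q m ε k (K + 1) ⊆ (Br m ∩ selmerS m ⁻¹' Q m ε k K) ∪
        ((Br m)ᶜ ∩ selmerS m ⁻¹' (W m ε k)ᶜ) := by
      rintro x ⟨n, hn, h1, h2, h3⟩
      rcases n with _ | n
      · exact Or.inr ⟨h2, h3⟩
      · refine Or.inl ⟨h1 0 (by omega), n, by omega, fun j hj => ?_, ?_, ?_⟩
        · rw [← Function.iterate_succ_apply]; exact h1 (j + 1) (by omega)
        · rw [← Function.iterate_succ_apply]; exact h2
        · rw [← Function.iterate_succ_apply]; exact h3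
    refine (V_union C hsub).trans ?_
    have a1 := (pull1 C (Br m ∩ selmerS m ⁻¹' Q m ε k K) (Q m ε k K)
      (fun x _ h => h)).trans (ih _ (vecMul_B1_pos hC))
    have a2 := (pull2 C ((Br m)ᶜ ∩ selmerS m ⁻¹' (W m ε k)ᶜ) (W m ε k)ᶜ
      (fun x _ h => h)).trans (hk _ (vecMul_B2_pos hC) (by
        rw [vecMul_B2, vecMul_B2]; simp; exact (hC 0).le))
    refine (add_le_add a1 a2).trans ?_
    rw [← mul_add]
    gcongr
    exact V_split C

/-- growth -/
lemma vecMul_step_le {m : ℕ} {C : Fin (m + 3) → ℝ} {M : ℝ} (hC : ∀ j, 0 < C j)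
    (hM : ∀ j, C j ≤ M) (x : Fin (m + 3) → ℝ) (j) :
    0 < (C ᵥ* selmerStep m x) j ∧ (C ᵥ* selmerStep m x) j ≤ 2 * M := by
  have hM0 : 0 < M := (hC 0).trans_le (hM 0)
  unfold selmerStep
  split_ifs
  · refine ⟨vecMul_B1_pos hC j, ?_⟩
    rw [vecMul_B1]
    split_ifs
    · linarith [hM 0, hM (Fin.last (m + 2))]
    · linarith [hM (Fin.last (m + 2))]
    · exact (hM _).trans (by linarith)
  · refine ⟨vecMul_B2_pos hC j, ?_⟩
    rw [vecMul_B2]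
    split_ifs
    · linarith [hM (Fin.last (m + 2))]
    · linarith [hM 0, hM (Fin.last (m + 2))]
    · exact (hM _).trans (by linarith)

lemma growth {m : ℕ} {C : Fin (m + 3) → ℝ} {M : ℝ} (x : Fin (m + 3) → ℝ) (n k : ℕ)
    (h : ∀ j, 0 < (C ᵥ* selmerMat m x n) j ∧ (C ᵥ* selmerMat m x n) j ≤ M) :
    ∀ j, 0 < (C ᵥ* selmerMat m x (n + k)) j ∧ (C ᵥ* selmerMat m x (n + k)) j ≤ 2 ^ k * M := by
  induction k with
  | zero => simpa using h
  | succ k ih =>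
    intro j
    rw [← add_assoc, selmerMat, ← vecMul_vecMul, pow_succ', mul_assoc]
    exact vecMul_step_le (fun j => (ih j).1) (fun j => (ih j).2) _ j

lemma mat_R {m : ℕ} (C x : Fin (m + 3) → ℝ) (n : ℕ) (h : x ∈ R m n) :
    C ᵥ* selmerMat m x n = (fun c => c ᵥ* selmerB1 m)^[n] C := by
  induction n with
  | zero => simp [selmerMat]
  | succ n ih =>
    rw [selmerMat, ← vecMul_vecMul, Function.iterate_succ_apply', ih (fun j hj => h j (by omega))]
    have : selmerStep m ((selmerS m)^[n] x) = selmerB1 m := if_pos (h n (by omega))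
    rw [this]

lemma Sg_B1 {m : ℕ} (C : Fin (m + 3) → ℝ) : Sg (C ᵥ* selmerB1 m) = Sg C := by
  have key : ∀ c : Fin (m + 3) → ℝ, Sg c = c ⬝ᵥ (fun i => if i = 0 then 0 else 1) := by
    intro c
    rw [dotProduct, Fin.sum_univ_succ, Sg]
    simp
  rw [key, key, ← dotProduct_mulVec]
  congr 1
  ext i
  rw [B1_mulVec]
  by_cases h1 : i = 0
  · simp [h1]
  · have h1' : (i : ℕ) ≠ 0 := fun h => h1 (Fin.ext h)
    by_cases h2 : (i : ℕ) = m + 2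
    · simp [h1, h2]
    · simp [h1, h1', h2, Fin.ext_iff]

lemma iter_B1 {m : ℕ} {C : Fin (m + 3) → ℝ} {c : ℝ} (hc : 0 < c) (hC : ∀ j, c ≤ C j) (n : ℕ) :
    (∀ j, c ≤ ((fun c => c ᵥ* selmerB1 m)^[n] C) j) ∧
    Sg ((fun c => c ᵥ* selmerB1 m)^[n] C) = Sg C ∧
    n * c ≤ ((fun c => c ᵥ* selmerB1 m)^[n] C) 0 := by
  induction n with
  | zero => exact ⟨hC, rfl, by simpa using hc.le.trans (hC 0)⟩
  | succ n ih =>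
    obtain ⟨h1, h2, h3⟩ := ih
    rw [Function.iterate_succ_apply']
    refine ⟨fun j => ?_, by rw [Sg_B1, h2], ?_⟩
    · rw [vecMul_B1]
      split_ifs
      · linarith [h1 0, h1 (Fin.last (m + 2))]
      · exact h1 _
      · exact h1 _
    · rw [vecMul_B1, if_pos (by simp)]
      push_cast
      linarith [h1 (Fin.last (m + 2))]

theorem cone_main (m : ℕ) (ρ : ℝ) (hρ0 : 0 < ρ) (hρ1 : ρ < 1) (ε : ℝ) (hε : 0 < ε) :
    ∃ D : ℝ, 0 < D ∧ ∀ C : Fin (m + 3) → ℝ, (∀ j, 0 < C j) →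
      ∃ G : Set (Fin (m + 3) → ℝ), MeasurableSet G ∧
        (∀ x, ∀ t : ℝ, 0 < t → (t • x ∈ G ↔ x ∈ G)) ∧
        (∀ x ∈ Om m, x ∈ G → ∃ i : ℕ, (selmerS m)^[i] x 1 < ε * x 0 ∧
          ∀ M, (∀ j, C j ≤ M) → ∀ j, (C ᵥ* selmerMat m x i) j ≤ D * M) ∧
        ENNReal.ofReal ρ * V C Set.univ ≤ V C G := by
  set η : ℝ := (1 - ρ) / 2 with hη
  have hη0 : 0 < η := by rw [hη]; linarith
  have hη1 : η ≤ 1 := by rw [hη]; linarith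
  obtain ⟨k, hk⟩ := good_est m hε hη0
  set κ : ℝ := 1 / η with hκd
  have hκ : 1 ≤ κ := by rw [hκd, le_div_iff₀ hη0]; linarith
  have hκ0 : 0 < κ := by linarith
  refine ⟨2 ^ k * (2 * (κ * (2 * m + 5))), by positivity, fun C hC => ?_⟩
  obtain ⟨c, hc0, hc⟩ : ∃ c : ℝ, 0 < c ∧ ∀ j, c ≤ C j := by
    obtain ⟨j0, hj0⟩ := Finite.exists_min C
    exact ⟨C j0, hC j0, hj0⟩
  have hex : ∃ K : ℕ, κ * (C 0 + 2 * Sg C) ≤ ((fun c => c ᵥ* selmerB1 m)^[K] C) 0 := by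
    obtain ⟨K, hK⟩ := exists_nat_ge (κ * (C 0 + 2 * Sg C) / c)
    refine ⟨K, le_trans ?_ (iter_B1 hc0 hc K).2.2⟩
    rwa [div_le_iff₀ hc0] at hK
  classical
  set K := Nat.find hex with hKdef
  have hK := Nat.find_spec hex
  have hKmin : ∀ n < K, ((fun c => c ᵥ* selmerB1 m)^[n] C) 0 < κ * (C 0 + 2 * Sg C) :=
    fun n hn => not_le.1 (Nat.find_min hex hn)
  refine ⟨(Q m ε k K)ᶜ ∩ (R m K)ᶜ, (meas_Q m ε k K).compl.inter (meas_R m K).compl, ?_, ?_, ?_⟩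
  · intro x t ht
    simp only [Set.mem_inter_iff, Set.mem_compl_iff, Q_smul ht, R_smul ht]
  · rintro x hx ⟨hQ, hR⟩
    have hR' : ∃ j, j < K ∧ (selmerS m)^[j] x ∉ Br m := by
      by_contra hcon
      push Not at hcon
      exact hR hcon
    set n := Nat.find hR' with hn
    obtain ⟨hnK, hnB⟩ := Nat.find_spec hR'
    have hRn : x ∈ R m n := by
      intro j hj
      by_contra hcon
      exact Nat.find_min hR' hj ⟨lt_trans hj hnK, hcon⟩
    have hW : (selmerS m)^[n + 1] x ∈ W m ε k := by
      by_contra hcon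
      exact hQ ⟨n, hnK, hRn, hnB, hcon⟩
    refine ⟨n + 1 + k, ?_, ?_⟩
    · rw [add_comm (n + 1) k, Function.iterate_add_apply]
      refine lt_of_lt_of_le hW ?_
      gcongr
      exact iter_zero_le hx _
    · intro M hM
      have hM0 : 0 < M := (hC 0).trans_le (hM 0)
      have hSgM : Sg C ≤ (m + 2) * M := by
        rw [Sg]
        refine (Finset.sum_le_card_nsmul _ _ M fun j _ => hM _).trans ?_
        simp
      have hb := iter_B1 hc0 hc n
      have hall : ∀ j, 0 < (C ᵥ* selmerMat m x n) j ∧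
          (C ᵥ* selmerMat m x n) j ≤ κ * (2 * m + 5) * M := by
        rw [mat_R C x n hRn]
        intro j
        refine ⟨hc0.trans_le (hb.1 j), ?_⟩
        have h5 : κ * (C 0 + 2 * Sg C) ≤ κ * (2 * m + 5) * M := by
          rw [mul_assoc]
          gcongr
          linarith [hM 0]
        refine Fin.cases ?_ (fun j => ?_) j
        · exact (hKmin n hnK).le.trans h5
        · have h6 : ((fun c => c ᵥ* selmerB1 m)^[n] C) j.succ ≤ Sg C := by
            rw [← hb.2.1]
            exact Finset.single_le_sum
              (f := fun j : Fin (m + 2) => ((fun c => c ᵥ* selmerB1 m)^[n] C) j.succ)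
              (fun j _ => hc0.le.trans (hb.1 _)) (Finset.mem_univ j)
          refine h6.trans (le_trans ?_ h5)
          have := Sg_pos hC
          nlinarith [hC 0]
      have h1 := growth x n 1 hall
      have h2 := growth x (n + 1) k h1
      intro j
      refine (h2 j).2.trans (le_of_eq ?_)
      ring
  · have hf := V_fin hC Set.univ
    have e1 : V C Set.univ ≤ V C ((Q m ε k K)ᶜ ∩ (R m K)ᶜ) + (V C (Q m ε k K) + V C (R m K)) := by
      refine (V_union C (U1 := (Q m ε k K)ᶜ ∩ (R m K)ᶜ) (U2 := Q m ε k K ∪ R m K) ?_).trans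
        (add_le_add le_rfl (V_union C subset_rfl))
      intro x _
      by_cases h1 : x ∈ Q m ε k K
      · exact Or.inr (Or.inl h1)
      · by_cases h2 : x ∈ R m K
        · exact Or.inr (Or.inr h2)
        · exact Or.inl ⟨h1, h2⟩
    have e2 := V_Q hk K C hC
    have hb := iter_B1 hc0 hc K
    have e3 : V C (R m K) ≤ ENNReal.ofReal η * V C Set.univ := by
      refine (V_R K C).trans ?_
      have := tail_est hκ hC (fun j => hc0.trans_le (hb.1 j)) hb.2.1 hK
      calc _ = ENNReal.ofReal η * (ENNReal.ofReal κ *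
            V ((fun c => c ᵥ* selmerB1 m)^[K] C) Set.univ) := by
            rw [← mul_assoc, ← ENNReal.ofReal_mul hη0.le, hκd, mul_one_div_cancel hη0.ne']; simp
        _ ≤ _ := by gcongr
    have e4 : V C Set.univ ≤ V C ((Q m ε k K)ᶜ ∩ (R m K)ᶜ) +
        ENNReal.ofReal (1 - ρ) * V C Set.univ := by
      refine e1.trans (add_le_add le_rfl ((add_le_add e2 e3).trans (le_of_eq ?_)))
      rw [← add_mul, ← ENNReal.ofReal_add hη0.le hη0.le]
      congr 2; rw [hη]; ring
    have e5 : V C Set.univ = ENNReal.ofReal ρ * V C Set.univ +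
        ENNReal.ofReal (1 - ρ) * V C Set.univ := by
      rw [← add_mul, ← ENNReal.ofReal_add hρ0.le (by linarith)]; simp
    have hfin : ENNReal.ofReal (1 - ρ) * V C Set.univ ≠ ∞ := ENNReal.mul_ne_top (by simp) hf.ne
    exact ENNReal.le_of_add_le_add_right hfin (e5.symm.le.trans e4)

end SelmerAux

namespace SelmerAux

open Matrix
open scoped ENNReal Pointwise

lemma inner_int (n : ℕ) {b : ℝ} (hb : 0 < b) :
    ∫⁻ s in Set.Ioc (0 : ℝ) b, ENNReal.ofReal (s ^ n) = ENNReal.ofReal (b ^ (n + 1) / (n + 1)) := by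
  rw [← ofReal_integral_eq_lintegral_ofReal]
  · rw [← intervalIntegral.integral_of_le hb.le, integral_pow]
    simp
  · exact (intervalIntegrable_iff_integrableOn_Ioc_of_le hb.le).1
      (Continuous.intervalIntegrable (by fun_prop) _ _)
  · filter_upwards [ae_restrict_mem measurableSet_Ioc] with s hs
    exact pow_nonneg hs.1.le _

lemma Om_dot_pos {m : ℕ} {C x : Fin (m + 3) → ℝ} (hC : ∀ j, 0 < C j) (hx : x ∈ Om m)
    (hs : ∑ i, x i = 1) : 0 < C ⬝ᵥ x := by
  have h0 : ∀ i, 0 ≤ x i := Om_nonneg hx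
  obtain ⟨i, -, hi⟩ : ∃ i ∈ Finset.univ, 0 < x i := by
    by_contra hcon
    push Not at hcon
    have := Finset.sum_nonpos hcon
    linarith
  exact Finset.sum_pos' (fun j _ => mul_nonneg (hC j).le (h0 j))
    ⟨i, Finset.mem_univ i, mul_pos (hC i) hi⟩

lemma cone_bridge {m : ℕ} {E : Type*} [NormedAddCommGroup E] [NormedSpace ℝ E]
    [FiniteDimensional ℝ E] [MeasurableSpace E] [BorelSpace E] (μ : Measure E)
    [μ.IsAddHaarMeasure] (hE : Module.finrank ℝ E = m + 2)
    (L : (ℝ × E) ≃L[ℝ] (Fin (m + 3) → ℝ)) (hL : ∀ p, ∑ i, L p i = p.1) :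
    ∃ c : ℝ≥0∞, c ≠ 0 ∧ c ≠ ∞ ∧ ∀ C : Fin (m + 3) → ℝ, (∀ j, 0 < C j) →
      ∀ U : Set (Fin (m + 3) → ℝ), MeasurableSet U →
      (∀ x, ∀ t : ℝ, 0 < t → (t • x ∈ U ↔ x ∈ U)) →
      V C U = c * ∫⁻ w in {w | L (1, w) ∈ Om m ∧ L (1, w) ∈ U},
        ENNReal.ofReal (((C ⬝ᵥ L (1, w)) ^ (m + 3))⁻¹) ∂μ := by
  have : SecondCountableTopology E := secondCountable_of_proper (α := E)
  have h1 : (Measure.map L ((volume : Measure ℝ).prod μ)).IsAddHaarMeasure :=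
    ContinuousLinearEquiv.isAddHaarMeasure_map L _
  have h2 := Measure.isAddLeftInvariant_eq_smul (volume : Measure (Fin (m + 3) → ℝ))
    (Measure.map L ((volume : Measure ℝ).prod μ))
  set c0 := Measure.addHaarScalarFactor (volume : Measure (Fin (m + 3) → ℝ))
    (Measure.map L ((volume : Measure ℝ).prod μ)) with hc0
  have hc0pos : 0 < c0 := Measure.addHaarScalarFactor_pos_of_isAddHaarMeasure _ _
  have hm3 : (0 : ℝ) < (m + 2 : ℕ) + 1 := by positivity
  refine ⟨c0 * ENNReal.ofReal (1 / ((m + 2 : ℕ) + 1)), ?_, ?_, ?_⟩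
  · refine mul_ne_zero (by exact_mod_cast hc0pos.ne') ?_
    rw [Ne, ENNReal.ofReal_eq_zero, not_le]; positivity
  · exact ENNReal.mul_ne_top ENNReal.coe_ne_top ENNReal.ofReal_ne_top
  intro C hC U hU hUs
  have hLc : Continuous L := L.continuous
  have hL1 : Measurable fun w : E => L (1, w) :=
    (hLc.comp (by fun_prop : Continuous fun w : E => ((1 : ℝ), w))).measurable
  have hdotc : Continuous fun x : Fin (m + 3) → ℝ => C ⬝ᵥ x := by
    unfold dotProduct; fun_prop
  set A : Set E := {w | L (1, w) ∈ Om m ∧ L (1, w) ∈ U} with hA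
  have hAm : MeasurableSet A := (hL1 (meas_Om m)).inter (hL1 hU)
  set q : E → ℝ := fun w => C ⬝ᵥ L (1, w) with hq
  have hqm : Measurable q := hdotc.measurable.comp hL1
  have hqpos : ∀ w ∈ A, 0 < q w := fun w hw => Om_dot_pos hC hw.1 (hL _)
  set T' : Set (ℝ × E) := {p | 0 < p.1 ∧ p.2 ∈ A ∧ p.1 * q p.2 ≤ 1} with hT'
  have memT : ∀ s w, (s, w) ∈ T' ↔ 0 < s ∧ w ∈ A ∧ s * q w ≤ 1 := fun _ _ => Iff.rfl
  have hT'm : MeasurableSet T' := by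
    refine MeasurableSet.inter (measurableSet_lt measurable_const measurable_fst) ?_
    exact (measurable_snd hAm).inter (measurableSet_le
      (measurable_fst.mul (hqm.comp measurable_snd)) measurable_const)
  set F : ℝ → E → ℝ≥0∞ := fun s w => T'.indicator (fun p => ENNReal.ofReal (p.1 ^ (m + 2))) (s, w)
    with hF
  have hFm : Measurable (Function.uncurry F) := by
    have : Function.uncurry F = T'.indicator (fun p => ENNReal.ofReal (p.1 ^ (m + 2))) := by
      ext ⟨s, w⟩; rfl
    rw [this]
    exact Measurable.indicator (by fun_prop) hT'm
  set T : Set (Fin (m + 3) → ℝ) := {x | x ∈ Om m ∧ x ∈ U ∧ C ⬝ᵥ x ≤ 1} with hT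
  have hTm : MeasurableSet T := (meas_Om m).inter (hU.inter
    (measurableSet_le hdotc.measurable measurable_const))
  have hsm : ∀ (s : ℝ) (w : E), L (s, s • w) = s • L (1, w) := by
    intro s w
    rw [← map_smul]; simp
  have step1 : V C U = c0 * ∫⁻ s, ∫⁻ w, F s w ∂μ := by
    have : V C U = volume T := rfl
    rw [this, h2, Measure.smul_apply, Measure.map_apply hLc.measurable hTm,
      Measure.prod_apply (hLc.measurable hTm)]
    rw [ENNReal.smul_def, smul_eq_mul]
    congr 1
    refine lintegral_congr_ae ?_
    have hne : ∀ᵐ s : ℝ, s ≠ 0 := by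
      simp [ae_iff]
    filter_upwards [hne] with s hs
    rcases lt_or_gt_of_ne hs with hs | hs
    · have e1 : Prod.mk s ⁻¹' (L ⁻¹' T) = ∅ := by
        ext w
        simp only [Set.mem_preimage, Set.mem_empty_iff_false, iff_false]
        rintro ⟨h, -, -⟩
        have := Finset.sum_nonneg fun i (_ : i ∈ Finset.univ) => Om_nonneg h i
        rw [hL] at this
        exact absurd hs (not_lt.2 this)
      have e2 : ∀ w, F s w = 0 := by
        intro w
        apply Set.indicator_of_notMem
        rintro ⟨h, -, -⟩
        exact absurd hs (not_lt.2 h.le)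
      simp [e1, e2]
    · have e1 : Prod.mk s ⁻¹' (L ⁻¹' T) = s • {w | w ∈ A ∧ s * q w ≤ 1} := by
        ext w
        rw [Set.mem_smul_set_iff_inv_smul_mem₀ hs.ne']
        have ew : L (s, w) = s • L (1, s⁻¹ • w) := by
          rw [← hsm, smul_inv_smul₀ hs.ne']
        show L (s, w) ∈ T ↔ _
        rw [ew]
        have o1 : s • L (1, s⁻¹ • w) ∈ Om m ↔ L (1, s⁻¹ • w) ∈ Om m := by
          refine ⟨fun h => ?_, fun h => Om_smul h hs⟩
          have := Om_smul h (inv_pos.2 hs)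
          rwa [inv_smul_smul₀ hs.ne'] at this
        simp only [hT, hA, hq, Set.mem_ofPred_eq, o1, hUs _ _ hs, dotProduct_smul, smul_eq_mul,
          and_assoc]
      rw [e1, Measure.addHaar_smul_of_nonneg _ hs.le, hE]
      have e2 : ∀ w, F s w = {w | w ∈ A ∧ s * q w ≤ 1}.indicator
          (fun _ => ENNReal.ofReal (s ^ (m + 2))) w := by
        intro w
        by_cases hw : w ∈ A ∧ s * q w ≤ 1
        · rw [Set.indicator_of_mem (show w ∈ {w | w ∈ A ∧ s * q w ≤ 1} from hw)]
          exact Set.indicator_of_mem ((memT s w).2 ⟨hs, hw⟩) _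
        · rw [Set.indicator_of_notMem (show w ∉ {w | w ∈ A ∧ s * q w ≤ 1} from hw)]
          exact Set.indicator_of_notMem (fun h => hw ((memT s w).1 h).2) _
      have hm' : MeasurableSet {w | w ∈ A ∧ s * q w ≤ 1} :=
        hAm.inter (measurableSet_le (hqm.const_mul s) measurable_const)
      simp only [e2]
      rw [lintegral_indicator hm', setLIntegral_const]
  rw [step1, lintegral_lintegral_swap hFm.aemeasurable, mul_assoc]
  congr 1
  rw [← lintegral_const_mul' _ _ ENNReal.ofReal_ne_top, ← lintegral_indicator hAm]
  refine lintegral_congr fun w => ?_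
  by_cases hw : w ∈ A
  · have hqw := hqpos w hw
    rw [Set.indicator_of_mem hw]
    have e3 : ∀ s, F s w = (Set.Ioc 0 (1 / q w)).indicator
        (fun s => ENNReal.ofReal (s ^ (m + 2))) s := by
      intro s
      simp only [hF, Set.indicator, memT, hw, true_and, Set.mem_Ioc,
        le_div_iff₀ hqw]
    simp only [e3]
    rw [lintegral_indicator measurableSet_Ioc, inner_int _ (by positivity),
      ← ENNReal.ofReal_mul (by positivity)]
    congr 1
    rw [_root_.one_div_pow]
    show 1 / q w ^ (m + 3) / _ = _ * (q w ^ (m + 3))⁻¹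
    field_simp
  · rw [Set.indicator_of_notMem hw]
    have e3 : ∀ s, F s w = 0 := by
      intro s
      apply Set.indicator_of_notMem
      rintro ⟨-, h, -⟩
      exact hw h
    simp [e3]

end SelmerAux

namespace SelmerAux

open Matrix
open scoped ENNReal

/-- Sum of the coordinates. -/
noncomputable def sumF (m : ℕ) : EuclideanSpace ℝ (Fin (m + 3)) →ₗ[ℝ] ℝ where
  toFun v := ∑ i, v i
  map_add' v w := by simp [Finset.sum_add_distrib]
  map_smul' c v := by simp [Finset.mul_sum]

/-- The linear hyperplane of vectors with zero sum. -/
noncomputable abbrev Hyp (m : ℕ) : Submodule ℝ (EuclideanSpace ℝ (Fin (m + 3))) :=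
  LinearMap.ker (sumF m)

/-- first basis vector -/
noncomputable def e0 (m : ℕ) : EuclideanSpace ℝ (Fin (m + 3)) := EuclideanSpace.single 0 1

lemma sum_e0 (m : ℕ) : sumF m (e0 m) = 1 := by
  simp [sumF, e0]

lemma finrank_Hyp (m : ℕ) : Module.finrank ℝ (Hyp m) = m + 2 := by
  have h := LinearMap.finrank_range_add_finrank_ker (sumF m)
  have hs : LinearMap.range (sumF m) = ⊤ := by
    rw [LinearMap.range_eq_top]
    intro y
    exact ⟨y • e0 m, by rw [map_smul, sum_e0]; simp⟩
  rw [hs, finrank_top, Module.finrank_self, finrank_euclideanSpace_fin] at h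
  show Module.finrank ℝ (LinearMap.ker (sumF m)) = m + 2
  omega

/-- coordinates adapted to the hyperplane -/
noncomputable def Lequiv (m : ℕ) : (ℝ × Hyp m) ≃ₗ[ℝ] (Fin (m + 3) → ℝ) where
  toFun p := WithLp.ofLp (p.1 • e0 m + (p.2 : EuclideanSpace ℝ (Fin (m + 3))))
  map_add' p q := by
    ext i; simp [add_mul]; ring
  map_smul' c p := by
    ext i; simp; ring
  invFun x := (sumF m (WithLp.toLp 2 x),
    ⟨WithLp.toLp 2 x - sumF m (WithLp.toLp 2 x) • e0 m, by
      rw [LinearMap.mem_ker, map_sub, map_smul, sum_e0]; simp⟩)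
  left_inv p := by
    have h : sumF m (p.2 : EuclideanSpace ℝ (Fin (m + 3))) = 0 := p.2.2
    have h2 : sumF m (p.1 • e0 m + (p.2 : EuclideanSpace ℝ (Fin (m + 3)))) = p.1 := by
      rw [map_add, map_smul, sum_e0, h]; simp
    ext1
    · exact h2
    · apply Subtype.ext
      show (p.1 • e0 m + (p.2 : EuclideanSpace ℝ (Fin (m + 3)))) -
        sumF m (p.1 • e0 m + (p.2 : EuclideanSpace ℝ (Fin (m + 3)))) • e0 m = _
      rw [h2]; abel
  right_inv x := by
    simp

lemma Lequiv_apply (m : ℕ) (p : ℝ × Hyp m) :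
    Lequiv m p = WithLp.ofLp (p.1 • e0 m + (p.2 : EuclideanSpace ℝ (Fin (m + 3)))) := rfl

lemma Lequiv_sum (m : ℕ) (p : ℝ × Hyp m) : ∑ i, Lequiv m p i = p.1 := by
  have h : sumF m (p.2 : EuclideanSpace ℝ (Fin (m + 3))) = 0 := p.2.2
  show sumF m (p.1 • e0 m + (p.2 : EuclideanSpace ℝ (Fin (m + 3)))) = p.1
  rw [map_add, map_smul, sum_e0, h]; simp

lemma bridge (m : ℕ) :
    ∃ c : ℝ≥0∞, c ≠ 0 ∧ c ≠ ∞ ∧ ∀ C : Fin (m + 3) → ℝ, (∀ j, 0 < C j) →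
      ∀ U : Set (Fin (m + 3) → ℝ), MeasurableSet U →
      (∀ x, ∀ t : ℝ, 0 < t → (t • x ∈ U ↔ x ∈ U)) →
      V C U = c * ∫⁻ v in {v : EuclideanSpace ℝ (Fin (m + 3)) | v ∈ selmerSimplexE m ∧
          WithLp.ofLp v ∈ U},
        ENNReal.ofReal (((∑ j, C j * v j) ^ (m + 3))⁻¹) ∂(μH[(m + 2 : ℝ)]) := by
  have hH : (μH[(m + 2 : ℝ)] : Measure (Hyp m)).IsAddHaarMeasure := by
    have := isAddHaarMeasure_hausdorffMeasure (E := Hyp m)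
    rw [finrank_Hyp] at this
    push_cast at this
    exact this
  obtain ⟨c, hc0, hc1, h⟩ := cone_bridge (μH[(m + 2 : ℝ)] : Measure (Hyp m)) (finrank_Hyp m)
    (Lequiv m).toContinuousLinearEquiv (Lequiv_sum m)
  refine ⟨c, hc0, hc1, fun C hC U hU hUs => ?_⟩
  rw [h C hC U hU hUs]
  congr 1
  set f : Hyp m → EuclideanSpace ℝ (Fin (m + 3)) :=
    fun w => e0 m + (w : EuclideanSpace ℝ (Fin (m + 3))) with hf
  have hiso : Isometry f := by
    refine Isometry.of_dist_eq fun a b => ?_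
    simp only [hf, dist_add_left]; rfl
  have hmap := hiso.map_hausdorffMeasure (d := (m + 2 : ℝ)) (Or.inl (by positivity))
  have hrange : ∀ v, v ∈ selmerSimplexE m → v ∈ Set.range f := by
    intro v hv
    refine ⟨⟨v - e0 m, ?_⟩, by simp [hf]⟩
    rw [LinearMap.mem_ker, map_sub, sum_e0]
    have : sumF m v = 1 := hv.2.2.2
    rw [this]; simp
  set S : Set (EuclideanSpace ℝ (Fin (m + 3))) :=
    {v | v ∈ selmerSimplexE m ∧ WithLp.ofLp v ∈ U} with hS
  have hofLp : Measurable (fun v : EuclideanSpace ℝ (Fin (m + 3)) => WithLp.ofLp v) := by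
    fun_prop
  have hSm : MeasurableSet S := by
    have : S = (fun v : EuclideanSpace ℝ (Fin (m + 3)) => WithLp.ofLp v) ⁻¹' (Om m ∩ U) ∩
        {v | ∑ i, v i = 1} := by
      ext v
      simp only [hS, selmerSimplexE, Om, Set.mem_ofPred_eq, Set.mem_inter_iff, Set.mem_preimage]
      tauto
    rw [this]
    exact (hofLp ((meas_Om m).inter hU)).inter
      (measurableSet_eq_fun (by fun_prop) measurable_const)
  have hr : (μH[(m + 2 : ℝ)] : Measure (EuclideanSpace ℝ (Fin (m + 3)))).restrict S =
      (Measure.map f μH[(m + 2 : ℝ)]).restrict S := by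
    rw [hmap, Measure.restrict_restrict hSm,
      Set.inter_eq_left.2 (fun v hv => hrange v hv.1)]
  rw [hr, setLIntegral_map hSm (by fun_prop) hiso.continuous.measurable]
  have hpre : f ⁻¹' S = {w | (Lequiv m).toContinuousLinearEquiv (1, w) ∈ Om m ∧
      (Lequiv m).toContinuousLinearEquiv (1, w) ∈ U} := by
    ext w
    have e1 : (Lequiv m).toContinuousLinearEquiv (1, w) = WithLp.ofLp (f w) := by
      show Lequiv m (1, w) = _
      rw [Lequiv_apply]; simp [hf]
    have e2 := Lequiv_sum m (1, w)
    have e3 : Lequiv m (1, w) = WithLp.ofLp (f w) := e1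
    rw [e3] at e2
    rw [Set.mem_ofPred_eq, e1]
    simp only [hS, selmerSimplexE, Om, Set.mem_ofPred_eq, Set.mem_preimage]
    simp only at e2
    tauto
  rw [hpre]
  refine lintegral_congr fun w => ?_
  have e1 : (Lequiv m).toContinuousLinearEquiv (1, w) = WithLp.ofLp (f w) := by
    show Lequiv m (1, w) = _
    rw [Lequiv_apply]; simp [hf]
  rw [e1]; rfl

lemma colSum_mul (m : ℕ) (N M : Matrix (Fin (m + 3)) (Fin (m + 3)) ℝ) :
    colSum m (N * M) = colSum m N ᵥ* M := by
  have key : ∀ A : Matrix (Fin (m + 3)) (Fin (m + 3)) ℝ, colSum m A = (fun _ => 1) ᵥ* A := by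
    intro A; ext j; simp [colSum, vecMul, dotProduct]
  rw [key, key, vecMul_vecMul]

lemma colSum_pos {m : ℕ} {N : Matrix (Fin (m + 3)) (Fin (m + 3)) ℝ}
    (hN : N ∈ Submonoid.closure {selmerB1 m, selmerB2 m}) : ∀ j, 0 < colSum m N j := by
  induction hN using Submonoid.closure_induction_right with
  | one => intro j; simp [colSum, Matrix.one_apply]
  | mul_right x hx y hy ih =>
    rw [colSum_mul]
    rcases hy with rfl | rfl
    · exact vecMul_B1_pos ih
    · exact vecMul_B2_pos ih

end SelmerAux

open SelmerAux Matrix ENNReal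

/-- For every `ρ ∈ (0,1)` and `ε > 0` there exists `D > 0` such that, regardless of the
past matrix `N` (any finite product of `B₁` and `B₂`, including the identity), with
conditional probability at least `ρ` the second coordinate drops below `ε` times the
initial first coordinate before the largest column sum increases by a factor of `D`. -/
theorem selmer_second_coordinate_decay (m : ℕ) (ρ : ℝ) (hρ0 : 0 < ρ) (hρ1 : ρ < 1)
    (ε : ℝ) (hε : 0 < ε) :
    ∃ D : ℝ, 0 < D ∧ ∀ N ∈ Submonoid.closure {selmerB1 m, selmerB2 m},
      ρ ≤ selmerCondP m N {v ∈ selmerSimplexE m | ∃ i : ℕ,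
        ((selmerS m)^[i] v) 1 < ε * v 0 ∧
        colMax m (N * selmerMat m v i) ≤ D * colMax m N} := by
  obtain ⟨D, hD, hmain⟩ := cone_main m ρ hρ0 hρ1 ε hε
  refine ⟨D, hD, fun N hN => ?_⟩
  have hC := colSum_pos hN
  set C := colSum m N with hCdef
  obtain ⟨G, hGm, hGs, hG, hV⟩ := hmain C hC
  obtain ⟨c, hc0, hc1, hb⟩ := bridge m
  have hb1 := hb C hC Set.univ MeasurableSet.univ (by simp)
  have hb2 := hb C hC G hGm hGs
  have hfin := V_fin hC Set.univ
  have hpos := V_pos hC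
  set g : EuclideanSpace ℝ (Fin (m + 3)) → ℝ := fun v => ((∑ j, C j * v j) ^ (m + 3))⁻¹ with hg
  set S1 : Set (EuclideanSpace ℝ (Fin (m + 3))) :=
    {v | v ∈ selmerSimplexE m ∧ WithLp.ofLp v ∈ G} with hS1
  have hset : {v : EuclideanSpace ℝ (Fin (m + 3)) | v ∈ selmerSimplexE m ∧
      WithLp.ofLp v ∈ (Set.univ : Set (Fin (m + 3) → ℝ))} = selmerSimplexE m := by
    ext; simp
  rw [hset] at hb1
  set I : ℝ≥0∞ := ∫⁻ v in selmerSimplexE m, ENNReal.ofReal (g v) ∂(μH[(m + 2 : ℝ)]) with hI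
  set J : ℝ≥0∞ := ∫⁻ v in S1, ENNReal.ofReal (g v) ∂(μH[(m + 2 : ℝ)]) with hJ
  have hb1' : V C Set.univ = c * I := hb1
  have hb2' : V C G = c * J := hb2
  have hIfin : I ≠ ∞ := by
    intro h
    rw [hb1', h, ENNReal.mul_top hc0] at hfin
    exact lt_irrefl _ hfin
  have hIpos : I ≠ 0 := by
    intro h
    rw [hb1', h, mul_zero] at hpos
    exact lt_irrefl _ hpos
  have hIJ : ENNReal.ofReal ρ * I ≤ J := by
    rw [hb1', hb2', mul_left_comm] at hV
    exact (ENNReal.mul_le_mul_iff_right hc0 hc1).1 hV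
  set U : Set (EuclideanSpace ℝ (Fin (m + 3))) := {v ∈ selmerSimplexE m | ∃ i : ℕ,
        ((selmerS m)^[i] v) 1 < ε * v 0 ∧
        colMax m (N * selmerMat m v i) ≤ D * colMax m N} with hU
  have hsub1 : S1 ⊆ U := by
    rintro v ⟨hv, hvG⟩
    refine ⟨hv, ?_⟩
    obtain ⟨i, hi1, hi2⟩ := hG v ⟨hv.1, hv.2.1, hv.2.2.1⟩ hvG
    refine ⟨i, hi1, ?_⟩
    refine ciSup_le fun j => ?_
    rw [colSum_mul]
    exact hi2 _ (fun j => le_ciSup (Set.finite_range C).bddAbove j) j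
  have hsub2 : U ⊆ selmerSimplexE m := fun v hv => hv.1
  have hgm : Measurable g := by
    rw [hg]; fun_prop
  have hms : MeasurableSet (selmerSimplexE m) := by
    have : selmerSimplexE m = (fun v : EuclideanSpace ℝ (Fin (m + 3)) => WithLp.ofLp v) ⁻¹' (Om m) ∩
        {v | ∑ i, v i = 1} := by
      ext v
      simp only [selmerSimplexE, Om, Set.mem_ofPred_eq, Set.mem_inter_iff, Set.mem_preimage]
      tauto
    rw [this]
    exact ((by fun_prop : Measurable fun v : EuclideanSpace ℝ (Fin (m + 3)) => WithLp.ofLp v)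
      (meas_Om m)).inter (measurableSet_eq_fun (by fun_prop) measurable_const)
  have hg0 : ∀ v ∈ selmerSimplexE m, 0 ≤ g v := by
    intro v hv
    have h1 : v.ofLp ∈ Om m := ⟨hv.1, hv.2.1, hv.2.2.1⟩
    have : 0 < C ⬝ᵥ v.ofLp := Om_dot_pos hC h1 hv.2.2.2
    exact (inv_pos.2 (pow_pos this _)).le
  have hae : 0 ≤ᵐ[(μH[(m + 2 : ℝ)]).restrict (selmerSimplexE m)] g := by
    filter_upwards [ae_restrict_mem hms] with v hv using hg0 v hv
  have hintg : IntegrableOn g (selmerSimplexE m) μH[(m + 2 : ℝ)] := by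
    refine ⟨hgm.aestronglyMeasurable, ?_⟩
    rw [hasFiniteIntegral_iff_ofReal hae]
    exact lt_top_iff_ne_top.2 hIfin
  have hmono : ∫ v in S1, g v ∂(μH[(m + 2 : ℝ)]) ≤ ∫ v in U, g v ∂(μH[(m + 2 : ℝ)]) := by
    refine setIntegral_mono_set (hintg.mono_set hsub2) ?_ hsub1.eventuallyLE
    exact ae_restrict_of_ae_restrict_of_subset hsub2 hae
  have e1 : ∫ v in selmerSimplexE m, g v ∂(μH[(m + 2 : ℝ)]) = I.toReal :=
    integral_eq_lintegral_of_nonneg_ae hae hgm.aestronglyMeasurable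
  have e2 : ∫ v in S1, g v ∂(μH[(m + 2 : ℝ)]) = J.toReal :=
    integral_eq_lintegral_of_nonneg_ae
      (ae_restrict_of_ae_restrict_of_subset (hsub1.trans hsub2) hae) hgm.aestronglyMeasurable
  have hJI : J ≤ I := lintegral_mono_set (hsub1.trans hsub2)
  show ρ ≤ (∫ v in U, g v ∂(μH[(m + 2 : ℝ)])) / (∫ v in selmerSimplexE m, g v ∂(μH[(m + 2 : ℝ)]))
  rw [e1, le_div_iff₀ (ENNReal.toReal_pos hIpos hIfin)]
  refine le_trans ?_ hmono
  rw [e2, ← ENNReal.toReal_ofReal hρ0.le, ← ENNReal.toReal_mul]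
  exact ENNReal.toReal_mono (ne_top_of_le_ne_top hIfin hJI) hIJ
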